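/- arXiv:2007.06479 — 4 statements merged into one kernel-verified Lean document; each statement's English description precedes it below -/
import Mathlib

section
/- Let T_i : ℝⁿ → ℝⁿ be continuous for all i ∈ I and let (X_k) be the RFI sequence generated from some initial distribution. If there exists M ≥ 0 such that E[‖X_k‖] ≤ M for all k ∈ ℕ, then there exists an invariant probability measure for the Markov operator 𝒫. -/
open MeasureTheory Filter Topology

/-- One application of the dual Markov operator of the RFI: `μ𝒫(A) = ∫ P(T_ξ x ∈ A) μ(dx)`,
where `μξ` is the law of `ξ`. -/
noncomputable def markovStep {G I : Type*} [MeasurableSpace G] [MeasurableSpace I]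
    (μξ : MeasureTheory.Measure I) (T : I → G → G) (μ : MeasureTheory.Measure G) :
    MeasureTheory.Measure G :=
  μ.bind fun x => μξ.map fun i => T i x

section MarkovStep

open scoped BoundedContinuousFunction

variable {E I : Type*} [MeasurableSpace E] [MeasurableSpace I] {T : I → E → E}
  {μξ : Measure I} [IsProbabilityMeasure μξ]

theorem markovStep_eq_map_prod (hΦ : Measurable fun p : E × I => T p.2 p.1)
    (μ : Measure E) [SFinite μ] :
    markovStep μξ T μ = (μ.prod μξ).map fun p => T p.2 p.1 := by
  have hmap : ∀ x, (μξ.map fun i => T i x) = (μξ.map (Prod.mk x)).map fun p => T p.2 p.1 :=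
    fun x => (Measure.map_map hΦ measurable_prodMk_left).symm
  have hmeas : Measurable fun x => μξ.map fun i => T i x := by
    simp_rw [hmap]
    exact (Measure.measurable_map _ hΦ).comp Measurable.map_prodMk_left
  ext s hs
  rw [markovStep, Measure.bind_apply hs hmeas.aemeasurable, Measure.map_apply hΦ hs,
    Measure.prod_apply (hΦ hs)]
  refine lintegral_congr fun x => ?_
  rw [hmap, Measure.map_apply hΦ hs, Measure.map_apply measurable_prodMk_left (hΦ hs)]

theorem isProbabilityMeasure_markovStep (hΦ : Measurable fun p : E × I => T p.2 p.1)
    (μ : Measure E) [IsProbabilityMeasure μ] : IsProbabilityMeasure (markovStep μξ T μ) := by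
  rw [markovStep_eq_map_prod hΦ]
  exact Measure.isProbabilityMeasure_map hΦ.aemeasurable

theorem isProbabilityMeasure_markovStep_iterate (hΦ : Measurable fun p : E × I => T p.2 p.1)
    (μ : Measure E) [IsProbabilityMeasure μ] (k : ℕ) :
    IsProbabilityMeasure ((markovStep μξ T)^[k] μ) := by
  induction k with
  | zero => simpa
  | succ k ih =>
    rw [Function.iterate_succ_apply']
    exact isProbabilityMeasure_markovStep hΦ _

/-- The average of the first `N + 1` laws of the chain started from `μ`. -/
noncomputable def cesaroMeasure (μξ : Measure I) (T : I → E → E) (μ : Measure E) (N : ℕ) :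
    Measure E :=
  (N + 1 : ENNReal)⁻¹ • ∑ k ∈ Finset.range (N + 1), (markovStep μξ T)^[k] μ

theorem lintegral_cesaroMeasure (μξ : Measure I) (T : I → E → E) (μ : Measure E) (N : ℕ)
    (f : E → ENNReal) :
    ∫⁻ x, f x ∂(cesaroMeasure μξ T μ N) =
      (N + 1 : ENNReal)⁻¹ * ∑ k ∈ Finset.range (N + 1), ∫⁻ x, f x ∂((markovStep μξ T)^[k] μ) := by
  rw [cesaroMeasure, lintegral_smul_measure, lintegral_finsetSum_measure, smul_eq_mul]

theorem lintegral_cesaroMeasure_le {μξ : Measure I} {T : I → E → E} {μ : Measure E}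
    {f : E → ENNReal} {C : ENNReal} (hC : ∀ k, ∫⁻ x, f x ∂((markovStep μξ T)^[k] μ) ≤ C) (N : ℕ) :
    ∫⁻ x, f x ∂(cesaroMeasure μξ T μ N) ≤ C := by
  rw [lintegral_cesaroMeasure]
  calc (N + 1 : ENNReal)⁻¹ * ∑ k ∈ Finset.range (N + 1), ∫⁻ x, f x ∂((markovStep μξ T)^[k] μ)
      ≤ (N + 1 : ENNReal)⁻¹ * ∑ k ∈ Finset.range (N + 1), C := by
        gcongr with k
        exact hC k
    _ = C := by
        rw [Finset.sum_const, Finset.card_range, nsmul_eq_mul, ← mul_assoc]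
        push_cast
        rw [ENNReal.inv_mul_cancel (by simp) (by finiteness), one_mul]

theorem isProbabilityMeasure_cesaroMeasure (hΦ : Measurable fun p : E × I => T p.2 p.1)
    (μ : Measure E) [IsProbabilityMeasure μ] (N : ℕ) :
    IsProbabilityMeasure (cesaroMeasure μξ T μ N) := by
  have := isProbabilityMeasure_markovStep_iterate (μξ := μξ) hΦ μ
  constructor
  rw [← lintegral_one, lintegral_cesaroMeasure]
  simp only [lintegral_one, measure_univ, Finset.sum_const, Finset.card_range, nsmul_eq_mul,
    mul_one]
  push_cast
  exact ENNReal.inv_mul_cancel (by simp) (by finiteness)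

variable [TopologicalSpace E] [BorelSpace E]

theorem integral_markovStep (hΦ : Measurable fun p : E × I => T p.2 p.1)
    (μ : Measure E) [IsProbabilityMeasure μ] (f : E →ᵇ ℝ) :
    ∫ x, f x ∂(markovStep μξ T μ) = ∫ x, ∫ i, f (T i x) ∂μξ ∂μ := by
  have hf : Measurable f := f.continuous.measurable
  rw [markovStep_eq_map_prod hΦ, integral_map hΦ.aemeasurable hf.aestronglyMeasurable,
    integral_prod]
  exact .of_bound (hf.comp hΦ).aestronglyMeasurable ‖f‖
    (ae_of_all _ fun p => f.norm_coe_le_norm _)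

/-- The Feller property: averaging over the random map preserves bounded continuous functions. -/
theorem exists_boundedContinuousFunction_integral_eq [FirstCountableTopology E]
    (hT : ∀ i, Continuous (T i)) (hΦ : Measurable fun p : E × I => T p.2 p.1) (f : E →ᵇ ℝ) :
    ∃ g : E →ᵇ ℝ, ∀ x, g x = ∫ i, f (T i x) ∂μξ := by
  have hbound : ∀ x i, ‖f (T i x)‖ ≤ ‖f‖ := fun x i => f.norm_coe_le_norm _
  have hcont : Continuous fun x => ∫ i, f (T i x) ∂μξ :=
    continuous_of_dominated
      (fun x => (f.continuous.measurable.comp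
        (hΦ.comp measurable_prodMk_left)).aestronglyMeasurable)
      (fun x => ae_of_all _ (hbound x)) (integrable_const ‖f‖)
      (ae_of_all _ fun i => f.continuous.comp (hT i))
  refine ⟨.ofNormedAddCommGroup _ hcont ‖f‖ fun x => ?_, fun x => rfl⟩
  simpa using norm_integral_le_of_norm_le_const (μ := μξ) (ae_of_all _ (hbound x))

theorem integral_cesaroMeasure (hΦ : Measurable fun p : E × I => T p.2 p.1)
    (μ : Measure E) [IsProbabilityMeasure μ] (N : ℕ) (f : E →ᵇ ℝ) :
    ∫ x, f x ∂(cesaroMeasure μξ T μ N) =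
      (N + 1 : ℝ)⁻¹ * ∑ k ∈ Finset.range (N + 1), ∫ x, f x ∂((markovStep μξ T)^[k] μ) := by
  have := isProbabilityMeasure_markovStep_iterate (μξ := μξ) hΦ μ
  rw [cesaroMeasure, integral_smul_measure, integral_finsetSum_measure fun k _ => f.integrable _,
    smul_eq_mul, ENNReal.toReal_inv]
  congr 2

/-- Averaged laws are asymptotically invariant: the difference telescopes. -/
theorem tendsto_integral_cesaroMeasure_sub (hΦ : Measurable fun p : E × I => T p.2 p.1)
    (μ : Measure E) [IsProbabilityMeasure μ] {f g : E →ᵇ ℝ}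
    (hg : ∀ x, g x = ∫ i, f (T i x) ∂μξ) :
    Tendsto (fun N => ∫ x, g x ∂(cesaroMeasure μξ T μ N) - ∫ x, f x ∂(cesaroMeasure μξ T μ N))
      atTop (𝓝 0) := by
  have := isProbabilityMeasure_markovStep_iterate (μξ := μξ) hΦ μ
  have hstep : ∀ k, ∫ x, g x ∂((markovStep μξ T)^[k] μ) =
      ∫ x, f x ∂((markovStep μξ T)^[k + 1] μ) := fun k => by
    rw [Function.iterate_succ_apply', integral_markovStep hΦ]
    simp_rw [hg]
  have hle : ∀ k, ‖∫ x, f x ∂((markovStep μξ T)^[k] μ)‖ ≤ ‖f‖ := fun k =>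
    f.norm_integral_le_norm _
  have hlim : Tendsto (fun N : ℕ => (N + 1 : ℝ)⁻¹ * (2 * ‖f‖)) atTop (𝓝 0) := by
    simpa using (tendsto_one_div_add_atTop_nhds_zero_nat (𝕜 := ℝ)).mul_const (2 * ‖f‖)
  refine squeeze_zero_norm (fun N => ?_) hlim
  rw [integral_cesaroMeasure hΦ, integral_cesaroMeasure hΦ, ← mul_sub, ← Finset.sum_sub_distrib]
  simp_rw [hstep]
  rw [Finset.sum_range_sub (fun k => ∫ x, f x ∂((markovStep μξ T)^[k] μ)), norm_mul,
    Real.norm_of_nonneg (by positivity : (0 : ℝ) ≤ (N + 1 : ℝ)⁻¹), two_mul]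
  gcongr
  exact (norm_sub_le _ _).trans (add_le_add (hle _) (hle _))

/-- **Krylov–Bogolyubov**: a Feller chain with tight averaged laws has an invariant law. -/
theorem exists_markovStep_eq_of_isTightMeasureSet [T2Space E] [FirstCountableTopology E]
    [HasOuterApproxClosed E] (hT : ∀ i, Continuous (T i))
    (hΦ : Measurable fun p : E × I => T p.2 p.1) (μ : Measure E) [IsProbabilityMeasure μ]
    (htight : IsTightMeasureSet (Set.range (cesaroMeasure μξ T μ))) :
    ∃ π : Measure E, IsProbabilityMeasure π ∧ markovStep μξ T π = π := by
  let ν : ℕ → ProbabilityMeasure E := fun N =>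
    ⟨cesaroMeasure μξ T μ N, isProbabilityMeasure_cesaroMeasure hΦ μ N⟩
  have hcompact : IsCompact (closure (Set.range ν)) := by
    refine isCompact_closure_of_isTightMeasureSet (htight.subset ?_)
    rintro _ ⟨_, ⟨N, rfl⟩, rfl⟩
    exact ⟨N, rfl⟩
  obtain ⟨π, -, hπ : Tendsto ν (hyperfilter ℕ) (𝓝 π)⟩ :=
    hcompact.ultrafilter_le_nhds ((hyperfilter ℕ).map ν)
      (le_principal_iff.2 (mem_map.2 (univ_mem' fun N => subset_closure ⟨N, rfl⟩)))
  rw [ProbabilityMeasure.tendsto_iff_forall_integral_tendsto] at hπ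
  have := isProbabilityMeasure_markovStep (μξ := μξ) hΦ (π : Measure E)
  refine ⟨π, inferInstance, ext_of_forall_integral_eq_of_IsFiniteMeasure fun f => ?_⟩
  obtain ⟨g, hg⟩ := exists_boundedContinuousFunction_integral_eq (μξ := μξ) hT hΦ f
  rw [integral_markovStep hΦ]
  simp_rw [← hg]
  exact sub_eq_zero.1 (tendsto_nhds_unique ((hπ g).sub (hπ f))
    ((tendsto_integral_cesaroMeasure_sub hΦ μ hg).mono_left Nat.hyperfilter_le_atTop))

end MarkovStep

theorem isTightMeasureSet_of_lintegral_nnnorm_le {E : Type*} [NormedAddCommGroup E]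
    [ProperSpace E] [MeasurableSpace E] [BorelSpace E] {S : Set (Measure E)} {C : ENNReal}
    (hC : C ≠ ⊤) (hS : ∀ μ ∈ S, ∫⁻ x, (‖x‖₊ : ENNReal) ∂μ ≤ C) : IsTightMeasureSet S := by
  refine isTightMeasureSet_of_tendsto_measure_norm_gt ?_
  have hlim : Tendsto (fun r : ℝ => C / ENNReal.ofReal r) atTop (𝓝 0) := by
    simpa using ENNReal.Tendsto.const_div ENNReal.tendsto_ofReal_atTop (Or.inr hC)
  refine tendsto_of_tendsto_of_tendsto_of_le_of_le' tendsto_const_nhds hlim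
    (Eventually.of_forall fun _ => zero_le) ?_
  filter_upwards [eventually_gt_atTop 0] with r hr
  refine iSup₂_le fun μ hμ => ?_
  calc μ {x | r < ‖x‖} ≤ μ {x | ENNReal.ofReal r ≤ (‖x‖₊ : ENNReal)} := by
        refine measure_mono fun x (hx : r < ‖x‖) => ?_
        change ENNReal.ofReal r ≤ ‖x‖ₑ
        rw [← ofReal_norm]
        exact ENNReal.ofReal_le_ofReal hx.le
    _ ≤ (∫⁻ x, (‖x‖₊ : ENNReal) ∂μ) / ENNReal.ofReal r :=
        meas_ge_le_lintegral_div (by fun_prop) (by simpa using hr) ENNReal.ofReal_ne_top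
    _ ≤ C / ENNReal.ofReal r := ENNReal.div_le_div_right (hS μ hμ) _

/-- existence in ℝⁿ: `T i : ℝⁿ → ℝⁿ` continuous, and the RFI sequence
`(X k)` started from some initial distribution `μ₀` (so `X k` has distribution `μ₀𝒫ᵏ`)
satisfies `E[‖X k‖] ≤ M` for all `k`.  Then the RFI Markov operator has an invariant
probability measure. -/
theorem stmt3
    {n : ℕ} {I : Type*} [MeasurableSpace I]
    (T : I → EuclideanSpace ℝ (Fin n) → EuclideanSpace ℝ (Fin n))
    (hT : ∀ i, Continuous (T i))
    (hΦ : Measurable fun p : EuclideanSpace ℝ (Fin n) × I => T p.2 p.1)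
    (μξ : Measure I) [IsProbabilityMeasure μξ]
    (μ₀ : Measure (EuclideanSpace ℝ (Fin n))) [IsProbabilityMeasure μ₀]
    (M : ℝ) (hM : 0 ≤ M)
    (hbdd : ∀ k : ℕ,
      ∫⁻ x, (‖x‖₊ : ENNReal) ∂((markovStep μξ T)^[k] μ₀) ≤ ENNReal.ofReal M) :
    ∃ π : Measure (EuclideanSpace ℝ (Fin n)),
      IsProbabilityMeasure π ∧ markovStep μξ T π = π := by
  refine exists_markovStep_eq_of_isTightMeasureSet hT hΦ μ₀
    (isTightMeasureSet_of_lintegral_nnnorm_le (ENNReal.ofReal_ne_top (r := M)) ?_)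
  rintro _ ⟨N, rfl⟩
  exact lintegral_cesaroMeasure_le hbdd N
end

section
/- Let G be a Polish space and let T_i : G → G be continuous for all i ∈ I. Then for any invariant probability measure π of the Markov operator 𝒫, the support of π is almost surely invariant under T_ξ: for P^ξ-almost every i ∈ I, T_i(Supp π) ⊆ Supp π. -/
open MeasureTheory Filter Topology

/-- The support of a measure: the set of points all of whose neighborhoods have
positive measure (the smallest closed set of full measure, on a Polish space). -/
def msupport {G : Type*} [TopologicalSpace G] [MeasurableSpace G]
    (μ : MeasureTheory.Measure G) : Set G :=
  {x | ∀ U ∈ nhds x, 0 < μ U}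

theorem msupport_eq_support {G : Type*} [TopologicalSpace G] [MeasurableSpace G]
    (μ : Measure G) : msupport μ = μ.support := by
  ext x
  exact (Measure.mem_support_iff_forall x).symm

theorem measurable_map_apply {G H I : Type*} [MeasurableSpace G] [MeasurableSpace H]
    [MeasurableSpace I] {T : I → G → H} (hΦ : Measurable fun p : G × I => T p.2 p.1)
    (μξ : Measure I) [SFinite μξ] :
    Measurable fun x => μξ.map fun i => T i x := by
  refine Measure.measurable_of_measurable_coe _ fun s hs => ?_
  have key (x : G) : (μξ.map fun i => T i x) s =
      μξ (Prod.mk x ⁻¹' ((fun p : G × I => T p.2 p.1) ⁻¹' s)) :=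
    Measure.map_apply (hΦ.comp measurable_prodMk_left) hs
  simp_rw [key]
  exact measurable_measure_prodMk_left (hΦ hs)

/-- An invariant measure charging no point outside a measurable set `S` is, for almost every
index, carried into `S` by the corresponding map. -/
theorem ae_ae_mem_of_markovStep_eq {G I : Type*} [MeasurableSpace G] [MeasurableSpace I]
    {T : I → G → G} (hΦ : Measurable fun p : G × I => T p.2 p.1)
    {μξ : Measure I} [SFinite μξ] {π : Measure G} [SFinite π]
    (hπ : markovStep μξ T π = π) {S : Set G} (hS : MeasurableSet S) (hπS : ∀ᵐ x ∂π, x ∈ S) :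
    ∀ᵐ i ∂μξ, ∀ᵐ x ∂π, T i x ∈ S := by
  refine (Measure.ae_ae_comm (p := fun x i => T i x ∈ S) (hΦ hS)).1 ?_
  rw [← hπ, markovStep] at hπS
  filter_upwards [Measure.ae_ae_of_ae_bind (measurable_map_apply hΦ μξ).aemeasurable hπS] with x hx
  exact ae_of_ae_map (hΦ.comp measurable_prodMk_left).aemeasurable hx

/-- invariance of the support of invariant measures: `G` Polish, each
`T i` continuous; for any invariant probability measure `π` of the RFI Markov operator,
for `P^ξ`-almost every `i` one has `T i (Supp π) ⊆ Supp π`. -/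
theorem stmt5
    {G I : Type*} [MetricSpace G] [TopologicalSpace.SeparableSpace G] [CompleteSpace G]
    [MeasurableSpace G] [BorelSpace G] [MeasurableSpace I]
    (T : I → G → G) (hT : ∀ i, Continuous (T i))
    (hΦ : Measurable fun p : G × I => T p.2 p.1)
    (μξ : Measure I) [IsProbabilityMeasure μξ]
    (π : Measure G) [IsProbabilityMeasure π]
    (hπinv : markovStep μξ T π = π) :
    ∀ᵐ i ∂μξ, (T i) '' (msupport π) ⊆ msupport π := by
  rw [msupport_eq_support]
  have := UniformSpace.secondCountable_of_separable G
  filter_upwards [ae_ae_mem_of_markovStep_eq hΦ hπinv Measure.isClosed_support.measurableSet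
    Measure.support_mem_ae] with i hi
  exact Set.image_subset_iff.2
    (Measure.support_subset_of_isClosed (Measure.isClosed_support.preimage (hT i)) hi)
end

section
/- Let G be a Polish space and let T_i : G → G be nonexpansive for all i ∈ I. Let π be an ergodic invariant probability measure for the Markov operator 𝒫. Then for any s, s̃ ∈ Supp π and any ε > 0 there exist δ > 0 and a sequence (k_j)_{j∈ℕ} of natural numbers such that p^{k_j}(s, B(s̃, ε)) ≥ δ for all j ∈ ℕ, where p^k(x,·) := δ_x𝒫ᵏ denotes the k-step transition probability and B(s̃,ε) the open ball of radius ε around s̃. -/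
open MeasureTheory Filter Topology

/-- `π` is an ergodic invariant probability measure for the RFI Markov operator:
`π` is invariant, and every `p`-invariant Borel set (`p(x,A) = 1` for all `x ∈ A`)
has `π`-measure `0` or `1`. -/
def IsErgodicInv {G I : Type*} [MeasurableSpace G] [MeasurableSpace I]
    (μξ : MeasureTheory.Measure I) (T : I → G → G) (π : MeasureTheory.Measure G) : Prop :=
  MeasureTheory.IsProbabilityMeasure π ∧ markovStep μξ T π = π ∧
    ∀ A : Set G, MeasurableSet A →
      (∀ x ∈ A, (μξ.map fun i => T i x) A = 1) → π A = 0 ∨ π A = 1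

/-- The Markov operator of the RFI acting on nonnegative functions. -/
noncomputable def markovFun {G I : Type*} [MeasurableSpace I]
    (μξ : Measure I) (T : I → G → G) (h : G → ENNReal) : G → ENNReal :=
  fun x => ∫⁻ i, h (T i x) ∂μξ

lemma iterate_markovFun_le_one {G I : Type*} [MeasurableSpace I] {T : I → G → G}
    {μξ : Measure I} [IsProbabilityMeasure μξ] {h : G → ENNReal} (hh : ∀ x, h x ≤ 1) (k : ℕ)
    (x : G) : (markovFun μξ T)^[k] h x ≤ 1 := by
  induction k generalizing x with
  | zero => exact hh x
  | succ k ih =>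
    rw [Function.iterate_succ_apply']
    calc ∫⁻ i, (markovFun μξ T)^[k] h (T i x) ∂μξ ≤ ∫⁻ _, 1 ∂μξ := lintegral_mono fun i => ih _
      _ = 1 := by simp

section Markov

variable {G I : Type*} [MeasurableSpace G] [MeasurableSpace I]
  {T : I → G → G} {μξ : Measure I}

lemma measurable_markovFun [SFinite μξ] (hΦ : Measurable fun p : G × I => T p.2 p.1)
    {h : G → ENNReal} (hh : Measurable h) : Measurable (markovFun μξ T h) :=
  Measurable.lintegral_prod_right' (f := fun p : G × I => h (T p.2 p.1)) (hh.comp hΦ)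

lemma measurable_iterate_markovFun [SFinite μξ] (hΦ : Measurable fun p : G × I => T p.2 p.1)
    {h : G → ENNReal} (hh : Measurable h) (k : ℕ) : Measurable ((markovFun μξ T)^[k] h) := by
  induction k with
  | zero => exact hh
  | succ k ih =>
    rw [Function.iterate_succ_apply']
    exact measurable_markovFun hΦ ih

lemma measurable_apply_of_uncurry (hΦ : Measurable fun p : G × I => T p.2 p.1) (x : G) :
    Measurable fun i => T i x :=
  hΦ.comp measurable_prodMk_left

lemma measurable_transition [SFinite μξ] (hΦ : Measurable fun p : G × I => T p.2 p.1) :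
    Measurable fun x => μξ.map fun i => T i x := by
  refine Measure.measurable_of_measurable_coe _ fun A hA => ?_
  simp_rw [Measure.map_apply (measurable_apply_of_uncurry hΦ _) hA]
  exact measurable_measure_prodMk_left (hΦ hA)

lemma lintegral_markovStep [SFinite μξ] (hΦ : Measurable fun p : G × I => T p.2 p.1)
    (μ : Measure G) {h : G → ENNReal} (hh : Measurable h) :
    ∫⁻ x, h x ∂(markovStep μξ T μ) = ∫⁻ x, markovFun μξ T h x ∂μ := by
  rw [markovStep, Measure.lintegral_bind (measurable_transition hΦ).aemeasurable hh.aemeasurable]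
  refine lintegral_congr fun x => ?_
  rw [lintegral_map hh (measurable_apply_of_uncurry hΦ x), markovFun]

lemma lintegral_iterate_markovStep [SFinite μξ] (hΦ : Measurable fun p : G × I => T p.2 p.1)
    (μ : Measure G) {h : G → ENNReal} (hh : Measurable h) (k : ℕ) :
    ∫⁻ x, h x ∂((markovStep μξ T)^[k] μ) = ∫⁻ x, (markovFun μξ T)^[k] h x ∂μ := by
  induction k generalizing μ with
  | zero => rfl
  | succ k ih =>
    rw [Function.iterate_succ_apply, Function.iterate_succ_apply', ih,
      lintegral_markovStep hΦ μ (measurable_iterate_markovFun hΦ hh k)]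

lemma iterate_markovStep_dirac_apply [SFinite μξ]
    (hΦ : Measurable fun p : G × I => T p.2 p.1) (x : G) {A : Set G} (hA : MeasurableSet A)
    (k : ℕ) :
    ((markovStep μξ T)^[k] (Measure.dirac x)) A = (markovFun μξ T)^[k] (A.indicator 1) x := by
  have hm : Measurable (A.indicator (1 : G → ENNReal)) := measurable_one.indicator hA
  rw [← lintegral_indicator_one hA, lintegral_iterate_markovStep hΦ _ hm,
    lintegral_dirac' _ (measurable_iterate_markovFun hΦ hm k)]

end Markov

section Nonexpansive

variable {G I : Type*} [MetricSpace G] [MeasurableSpace I] {T : I → G → G} {μξ : Measure I}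

lemma iterate_markovFun_ball_le (hT : ∀ i x y, dist (T i x) (T i y) ≤ dist x y) (z : G)
    {r η : ℝ} (k : ℕ) {x y : G} (hxy : dist x y ≤ η) :
    (markovFun μξ T)^[k] ((Metric.ball z r).indicator 1) x ≤
      (markovFun μξ T)^[k] ((Metric.ball z (r + η)).indicator 1) y := by
  induction k generalizing x y with
  | zero =>
    by_cases hx : x ∈ Metric.ball z r
    · have hy : y ∈ Metric.ball z (r + η) := by
        rw [Metric.mem_ball] at hx ⊢
        linarith [dist_triangle y x z, dist_comm x y]
      simp [Set.indicator_of_mem hx, Set.indicator_of_mem hy]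
    · simp [Set.indicator_of_notMem hx]
  | succ k ih =>
    rw [Function.iterate_succ_apply', Function.iterate_succ_apply']
    exact lintegral_mono fun i => ih ((hT i x y).trans hxy)

lemma mul_iterate_markovFun_ball_le [MeasurableSpace G] [BorelSpace G]
    (hT : ∀ i x y, dist (T i x) (T i y) ≤ dist x y)
    (hm : ∀ x, Measurable fun i => T i x) (z x y : G) (r η : ℝ) (k : ℕ) :
    (μξ.map fun i => T i x) (Metric.ball y η) *
        (markovFun μξ T)^[k] ((Metric.ball z r).indicator 1) y ≤
      (markovFun μξ T)^[k + 1] ((Metric.ball z (r + η)).indicator 1) x := by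
  rw [Function.iterate_succ_apply', Measure.map_apply (hm x) Metric.isOpen_ball.measurableSet,
    mul_comm, ← setLIntegral_const]
  refine (setLIntegral_mono' (hm x Metric.isOpen_ball.measurableSet) fun i hi => ?_).trans
    (setLIntegral_le_lintegral _ _)
  refine iterate_markovFun_ball_le hT z k ?_
  rw [dist_comm]
  exact (Metric.mem_ball.1 hi).le

/-- The points from which every ball around `z` of radius less than `r` is asymptotically
never visited. -/
def escapeSet (μξ : Measure I) (T : I → G → G) (z : G) (r : ℝ) : Set G :=
  {x | ∀ t < r, Tendsto (fun k => (markovFun μξ T)^[k] ((Metric.ball z t).indicator 1) x)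
    atTop (𝓝 0)}

lemma isClosed_escapeSet (hT : ∀ i x y, dist (T i x) (T i y) ≤ dist x y) (z : G) (r : ℝ) :
    IsClosed (escapeSet μξ T z r) := by
  refine isClosed_of_closure_subset fun x hx t ht => ?_
  obtain ⟨y, hy, hxy⟩ := Metric.mem_closure_iff.1 hx ((r - t) / 2) (by linarith)
  exact tendsto_of_tendsto_of_tendsto_of_le_of_le tendsto_const_nhds
    (hy (t + (r - t) / 2) (by linarith)) (fun _ => zero_le)
    fun k => iterate_markovFun_ball_le hT z k hxy.le

lemma transition_escapeSet [SecondCountableTopology G] [MeasurableSpace G] [BorelSpace G]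
    [IsProbabilityMeasure μξ]
    (hT : ∀ i x y, dist (T i x) (T i y) ≤ dist x y) (hm : ∀ x, Measurable fun i => T i x)
    {z x : G} {r : ℝ} (hx : x ∈ escapeSet μξ T z r) :
    (μξ.map fun i => T i x) (escapeSet μξ T z r) = 1 := by
  have := Measure.isProbabilityMeasure_map (μ := μξ) (hm x).aemeasurable
  refine (prob_compl_eq_zero_iff (isClosed_escapeSet hT z r).measurableSet).1 ?_
  refine mem_ae_iff.1 (mem_of_superset (Measure.support_mem_ae) fun y hy t ht => ?_)
  have hpos : 0 < (μξ.map fun i => T i x) (Metric.ball y ((r - t) / 2)) :=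
    (Measure.mem_support_iff_forall _).1 hy _ (Metric.ball_mem_nhds y (by linarith))
  have hlim := (tendsto_add_atTop_iff_nat 1).2 (hx (t + (r - t) / 2) (by linarith))
  have hmul : Tendsto (fun k => (μξ.map fun i => T i x) (Metric.ball y ((r - t) / 2)) *
      (markovFun μξ T)^[k] ((Metric.ball z t).indicator 1) y) atTop (𝓝 0) :=
    tendsto_of_tendsto_of_tendsto_of_le_of_le tendsto_const_nhds hlim (fun _ => zero_le)
      fun k => mul_iterate_markovFun_ball_le hT hm z x y t _ k
  have hdiv := ENNReal.Tendsto.const_mul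
    (a := ((μξ.map fun i => T i x) (Metric.ball y ((r - t) / 2)))⁻¹) hmul
    (Or.inr (ENNReal.inv_ne_top.2 hpos.ne'))
  simpa only [← mul_assoc, ENNReal.inv_mul_cancel hpos.ne' (measure_ne_top _ _), one_mul,
    mul_zero] using hdiv

lemma measure_escapeSet_ne_one [SecondCountableTopology G] [MeasurableSpace G] [BorelSpace G]
    [IsProbabilityMeasure μξ] (hT : ∀ i x y, dist (T i x) (T i y) ≤ dist x y)
    (hΦ : Measurable fun p : G × I => T p.2 p.1) {π : Measure G} [IsProbabilityMeasure π]
    (hinv : markovStep μξ T π = π) {z : G} (hz : z ∈ msupport π) {r : ℝ} (hr : 0 < r) :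
    π (escapeSet μξ T z r) ≠ 1 := by
  intro h
  have hae : ∀ᵐ x ∂π, x ∈ escapeSet μξ T z r :=
    mem_ae_iff.2
      ((prob_compl_eq_zero_iff (isClosed_escapeSet hT z r).measurableSet).2 h)
  have hB : MeasurableSet (Metric.ball z (r / 2)) := Metric.isOpen_ball.measurableSet
  have hm : Measurable ((Metric.ball z (r / 2)).indicator (1 : G → ENNReal)) :=
    measurable_one.indicator hB
  have hlim := tendsto_lintegral_of_dominated_convergence (μ := π)
    (F := fun k => (markovFun μξ T)^[k] ((Metric.ball z (r / 2)).indicator 1))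
    (f := fun _ => 0) (fun _ => 1) (measurable_iterate_markovFun hΦ hm)
    (fun k => Eventually.of_forall fun x =>
      iterate_markovFun_le_one (Set.indicator_le_self _ _) k x) (by simp)
    (hae.mono fun x hx => hx (r / 2) (by linarith))
  have hconst (k : ℕ) :
      ∫⁻ x, (markovFun μξ T)^[k] ((Metric.ball z (r / 2)).indicator 1) x ∂π =
        π (Metric.ball z (r / 2)) := by
    rw [← lintegral_iterate_markovStep hΦ π hm, Function.iterate_fixed hinv,
      lintegral_indicator_one hB]
  simp only [hconst, lintegral_zero, tendsto_const_nhds_iff] at hlim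
  exact (hz _ (Metric.ball_mem_nhds z (by linarith))).ne' hlim

end Nonexpansive

/-- positive transition probability for ergodic measures: `G` Polish,
each `T i` nonexpansive, `π` ergodic invariant; then for any `s, s̃ ∈ Supp π` and any
`ε > 0` there are `δ > 0` and a (strictly increasing) sequence `(k j)` with
`p^{k j}(s, B(s̃,ε)) ≥ δ` for all `j`. -/
theorem stmt6
    {G I : Type*} [MetricSpace G] [TopologicalSpace.SeparableSpace G] [CompleteSpace G]
    [MeasurableSpace G] [BorelSpace G] [MeasurableSpace I]
    (T : I → G → G) (hT : ∀ i x y, dist (T i x) (T i y) ≤ dist x y)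
    (hΦ : Measurable fun p : G × I => T p.2 p.1)
    (μξ : Measure I) [IsProbabilityMeasure μξ]
    (π : Measure G) (hπ : IsErgodicInv μξ T π)
    (s s' : G) (hs : s ∈ msupport π) (hs' : s' ∈ msupport π) :
    ∀ ε : ℝ, 0 < ε → ∃ δ : ENNReal, 0 < δ ∧ ∃ k : ℕ → ℕ, StrictMono k ∧
      ∀ j : ℕ, δ ≤ ((markovStep μξ T)^[k j] (MeasureTheory.Measure.dirac s))
        (Metric.ball s' ε) := by
  intro ε hε
  obtain ⟨hprob, hinv, herg⟩ := hπ
  have hm := measurable_apply_of_uncurry hΦ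
  have hsc : SecondCountableTopology G := UniformSpace.secondCountable_of_separable G
  simp_rw [iterate_markovStep_dirac_apply hΦ s Metric.isOpen_ball.measurableSet]
  by_cases hlim : Tendsto
      (fun k => (markovFun μξ T)^[k] ((Metric.ball s' ε).indicator 1) s) atTop (𝓝 0)
  · exfalso
    have hsub : Metric.ball s (ε / 2) ⊆ escapeSet μξ T s' (ε / 2) := by
      intro x hx t ht
      refine tendsto_of_tendsto_of_tendsto_of_le_of_le tendsto_const_nhds hlim
        (fun _ => zero_le) fun k => ?_
      have hdist : dist x s ≤ ε - t := by linarith [Metric.mem_ball.1 hx]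
      simpa using iterate_markovFun_ball_le (μξ := μξ) hT s' (r := t) k hdist
    rcases herg _ (isClosed_escapeSet hT s' (ε / 2)).measurableSet
      (fun x hx => transition_escapeSet hT hm hx) with h0 | h1
    · exact (hs _ (Metric.ball_mem_nhds s (half_pos hε))).ne' (measure_mono_null hsub h0)
    · exact measure_escapeSet_ne_one hT hΦ hinv hs' (half_pos hε) h1
  · rw [ENNReal.tendsto_nhds_zero] at hlim
    push Not at hlim
    obtain ⟨δ, hδ, hfreq⟩ := hlim
    obtain ⟨k, hk, hle⟩ := extraction_of_frequently_atTop hfreq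
    exact ⟨δ, hδ, k, hk, fun j => (hle j).le⟩
end

section
/- Let T_i : ℝⁿ → ℝⁿ be α-firmly nonexpansive with constants α_i ≤ α < 1 for all i ∈ I (that is, ‖T_i x − T_i y‖² ≤ ‖x−y‖² − ((1−α_i)/α_i)‖(x−T_i x)−(y−T_i y)‖² for all x,y ∈ ℝⁿ), and assume the Markov operator 𝒫 possesses an invariant probability measure. Then for every initial distribution μ₀ on ℝⁿ, the distributions μ₀𝒫ᵏ of the RFI iterates converge in distribution (equivalently, in the Prokhorov–Lévy metric) to an invariant probability measure for 𝒫. -/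
open MeasureTheory Filter Topology

open scoped BoundedContinuousFunction

/-- A linear operator between spaces of bounded continuous functions is Markov if it is positive
and preserves the constant function one. -/
structure IsMarkovOp {X Y : Type*} [TopologicalSpace X] [TopologicalSpace Y]
    (A : (Y →ᵇ ℝ) →ₗ[ℝ] (X →ᵇ ℝ)) : Prop where
  nonneg : ∀ f : Y →ᵇ ℝ, (∀ y, 0 ≤ f y) → ∀ x, 0 ≤ A f x
  one : A 1 = 1

namespace IsMarkovOp

variable {X Y Z : Type*} [TopologicalSpace X] [TopologicalSpace Y] [TopologicalSpace Z]
  {A : (Y →ᵇ ℝ) →ₗ[ℝ] (X →ᵇ ℝ)}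

lemma mono (hA : IsMarkovOp A) {f g : Y →ᵇ ℝ} (h : ∀ y, f y ≤ g y) (x : X) : A f x ≤ A g x := by
  have := hA.nonneg (g - f) (fun y => by simpa using h y) x
  simpa [map_sub] using this

lemma comp {B : (Z →ᵇ ℝ) →ₗ[ℝ] (Y →ᵇ ℝ)} (hA : IsMarkovOp A) (hB : IsMarkovOp B) :
    IsMarkovOp (A ∘ₗ B) where
  nonneg f hf := hA.nonneg _ (hB.nonneg f hf)
  one := by simp [hA.one, hB.one]

lemma pow {A : (X →ᵇ ℝ) →ₗ[ℝ] (X →ᵇ ℝ)} (hA : IsMarkovOp A) (k : ℕ) : IsMarkovOp (A ^ k) := by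
  induction k with
  | zero => exact ⟨fun f hf => by simpa using hf, by simp⟩
  | succ k ih =>
    rw [pow_succ]
    exact ih.comp hA

lemma le_add_mul (hA : IsMarkovOp A) {f g : Y →ᵇ ℝ} {a b : ℝ} (h : ∀ y, f y ≤ a + b * g y)
    (x : X) : A f x ≤ a + b * A g x := by
  have := hA.mono (f := f) (g := a • 1 + b • g) (fun y => by simpa using h y) x
  simpa [hA.one] using this

lemma abs_le_add_mul (hA : IsMarkovOp A) {f g : Y →ᵇ ℝ} {a b : ℝ}
    (h : ∀ y, |f y| ≤ a + b * g y) (x : X) : |A f x| ≤ a + b * A g x := by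
  refine abs_le.2 ⟨?_, hA.le_add_mul (fun y => (le_abs_self _).trans (h y)) x⟩
  have := hA.le_add_mul (f := -f) (g := g) (a := a) (b := b)
    (fun y => (neg_le_abs _).trans (h y)) x
  simp only [map_neg, BoundedContinuousFunction.coe_neg, Pi.neg_apply] at this
  linarith

lemma abs_le (hA : IsMarkovOp A) {f : Y →ᵇ ℝ} {a : ℝ} (h : ∀ y, |f y| ≤ a) (x : X) :
    |A f x| ≤ a := by
  simpa using hA.abs_le_add_mul (g := 0) (b := 0) (fun y => by simpa using h y) x

end IsMarkovOp

lemma integrable_bcf_comp {I Y : Type*} [MeasurableSpace I] [TopologicalSpace Y]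
    [MeasurableSpace Y] [OpensMeasurableSpace Y] {ν : Measure I} [IsProbabilityMeasure ν]
    (f : Y →ᵇ ℝ) {g : I → Y} (hg : Measurable g) : Integrable (fun i => f (g i)) ν :=
  Integrable.of_bound (f.continuous.measurable.comp hg).aestronglyMeasurable ‖f‖
    (Eventually.of_forall fun _ => f.norm_coe_le_norm _)

/-- The average `x ↦ ∫ f (S i x) dν(i)` of a random continuous map, acting on bounded continuous
functions. -/
noncomputable def avgOp {I X Y : Type*} [MeasurableSpace I] [TopologicalSpace X]
    [FirstCountableTopology X] [TopologicalSpace Y] [MeasurableSpace Y] [OpensMeasurableSpace Y]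
    (ν : Measure I) [IsProbabilityMeasure ν] (S : I → X → Y)
    (hm : ∀ x, Measurable fun i => S i x) (hc : ∀ i, Continuous (S i)) :
    (Y →ᵇ ℝ) →ₗ[ℝ] (X →ᵇ ℝ) where
  toFun f := BoundedContinuousFunction.ofNormedAddCommGroup (fun x => ∫ i, f (S i x) ∂ν)
    (continuous_of_dominated
      (fun x => ((f.continuous.measurable.comp (hm x)).aestronglyMeasurable))
      (fun x => Eventually.of_forall fun i => f.norm_coe_le_norm (S i x))
      (integrable_const ‖f‖)
      (Eventually.of_forall fun i => f.continuous.comp (hc i)))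
    ‖f‖ (fun x => by
      simpa using norm_integral_le_of_norm_le_const (μ := ν)
        (Eventually.of_forall fun i => f.norm_coe_le_norm (S i x)))
  map_add' f g := by
    ext x
    exact integral_add
      (integrable_bcf_comp f (hm x)) (integrable_bcf_comp g (hm x))
  map_smul' c f := by
    ext x
    exact integral_const_mul c _

section avgOp

variable {I X Y : Type*} [MeasurableSpace I] [TopologicalSpace X]
    [FirstCountableTopology X] [TopologicalSpace Y] [MeasurableSpace Y] [OpensMeasurableSpace Y]
    {ν : Measure I} [IsProbabilityMeasure ν] {S : I → X → Y}
    {hm : ∀ x, Measurable fun i => S i x} {hc : ∀ i, Continuous (S i)}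

lemma avgOp_apply (f : Y →ᵇ ℝ) (x : X) : avgOp ν S hm hc f x = ∫ i, f (S i x) ∂ν := rfl

lemma isMarkovOp_avgOp : IsMarkovOp (avgOp ν S hm hc) where
  nonneg f hf x := integral_nonneg fun _ => hf _
  one := by ext x; simp [avgOp_apply]

end avgOp

/-- A cutoff function equal to one outside the ball of radius `R + 1`. -/
noncomputable def tailFun (E : Type*) [NormedAddCommGroup E] (R : ℕ) : E →ᵇ ℝ :=
  BoundedContinuousFunction.ofNormedAddCommGroup (fun x => min 1 (‖x‖ / (R + 1))) (by fun_prop) 1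
    (fun x => by
      rw [Real.norm_of_nonneg (by positivity)]
      exact min_le_left _ _)

section tail

variable {E : Type*} [NormedAddCommGroup E]

lemma tailFun_apply (R : ℕ) (x : E) : tailFun E R x = min 1 (‖x‖ / (R + 1)) := rfl

lemma tailFun_nonneg (R : ℕ) (x : E) : 0 ≤ tailFun E R x := by
  rw [tailFun_apply]; positivity

lemma tailFun_le_one (R : ℕ) (x : E) : tailFun E R x ≤ 1 := min_le_left _ _

lemma tailFun_eq_one {R : ℕ} {x : E} (h : (R : ℝ) + 1 ≤ ‖x‖) : tailFun E R x = 1 :=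
  min_eq_left ((one_le_div (by positivity)).2 h)

lemma tailFun_lipschitz (R : ℕ) (x y : E) :
    |tailFun E R x - tailFun E R y| ≤ (1 / (R + 1)) * ‖x - y‖ := by
  rw [tailFun_apply, tailFun_apply]
  refine (abs_min_sub_min_le_max _ _ _ _).trans ?_
  rw [sub_self, abs_zero, max_eq_right (abs_nonneg _), ← sub_div, abs_div,
    abs_of_pos (by positivity : (0 : ℝ) < R + 1), one_div_mul_eq_div]
  gcongr
  exact abs_norm_sub_norm_le x y

lemma tendsto_tailFun (x : E) : Tendsto (fun R => tailFun E R x) atTop (𝓝 0) := by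
  have h : Tendsto (fun R : ℕ => ‖x‖ / ((R : ℝ) + 1)) atTop (𝓝 0) :=
    tendsto_const_nhds.div_atTop (tendsto_natCast_atTop_atTop.atTop_add tendsto_const_nhds)
  exact squeeze_zero (fun R => tailFun_nonneg R x) (fun R => min_le_right _ _) h

lemma tendsto_integral_tailFun [MeasurableSpace E] [OpensMeasurableSpace E] (μ : Measure E)
    [IsProbabilityMeasure μ] : Tendsto (fun R => ∫ x, tailFun E R x ∂μ) atTop (𝓝 0) := by
  have := tendsto_integral_of_dominated_convergence (μ := μ) (F := fun R x => tailFun E R x)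
    (f := fun _ => 0) (fun _ => 1)
    (fun R => (tailFun E R).continuous.measurable.aestronglyMeasurable) (integrable_const 1)
    (fun R => Eventually.of_forall fun x => by
      rw [Real.norm_of_nonneg (tailFun_nonneg R x)]; exact tailFun_le_one R x)
    (Eventually.of_forall tendsto_tailFun)
  simpa using this

end tail

/-- The operator does not increase Lipschitz constants. -/
def PreservesLipschitz {E : Type*} [NormedAddCommGroup E] (P : (E →ᵇ ℝ) →ₗ[ℝ] (E →ᵇ ℝ)) : Prop :=
  ∀ (L : ℝ) (f : E →ᵇ ℝ), (∀ x y, |f x - f y| ≤ L * ‖x - y‖) →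
    ∀ x y, |P f x - P f y| ≤ L * ‖x - y‖

/-- The orbits of the operator are uniformly concentrated on balls. -/
def OrbitTight {E : Type*} [NormedAddCommGroup E] (P : (E →ᵇ ℝ) →ₗ[ℝ] (E →ᵇ ℝ)) : Prop :=
  ∀ x : E, ∀ ε > 0, ∃ R : ℕ, ∀ k : ℕ, (P ^ k) (tailFun E R) x ≤ ε

section orbits

variable {E : Type*} [NormedAddCommGroup E] {P : (E →ᵇ ℝ) →ₗ[ℝ] (E →ᵇ ℝ)}

lemma PreservesLipschitz.pow (hL : PreservesLipschitz P) (k : ℕ) :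
    PreservesLipschitz (P ^ k) := by
  induction k with
  | zero => intro L f hf; simpa using hf
  | succ k ih =>
    intro L f hf
    rw [pow_succ]
    exact ih L _ (hL L f hf)

lemma pow_tailFun_le_add (hP : IsMarkovOp P) (hL : PreservesLipschitz P) (R k : ℕ) (x y : E) :
    (P ^ k) (tailFun E R) x ≤ (P ^ k) (tailFun E R) y + tailFun E R x + tailFun E R y := by
  have h1 := hL.pow k _ _ (tailFun_lipschitz R) x y
  have h2 := (hP.pow k).nonneg _ (tailFun_nonneg (E := E) R) y
  have h3 := (hP.pow k).le_add_mul (f := tailFun E R) (g := 0) (a := 1) (b := 0)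
    (fun y => by simpa using tailFun_le_one R y) x
  simp only [map_zero, zero_mul, add_zero] at h3
  have h4 := tailFun_nonneg R x
  have h5 := tailFun_nonneg R y
  by_cases hx : (R : ℝ) + 1 ≤ ‖x‖
  · rw [tailFun_eq_one hx]; linarith
  by_cases hy : (R : ℝ) + 1 ≤ ‖y‖
  · rw [tailFun_eq_one hy]; linarith
  push Not at hx hy
  have e1 : tailFun E R x = ‖x‖ / (R + 1) :=
    min_eq_right ((div_le_one (by positivity)).2 hx.le)
  have e2 : tailFun E R y = ‖y‖ / (R + 1) :=
    min_eq_right ((div_le_one (by positivity)).2 hy.le)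
  have h6 : (1 / ((R : ℝ) + 1)) * ‖x - y‖ ≤ ‖x‖ / (R + 1) + ‖y‖ / (R + 1) := by
    rw [one_div_mul_eq_div, ← add_div]
    gcongr
    exact norm_sub_le x y
  rw [e1, e2]
  linarith [(abs_le.1 h1).2]

variable [MeasurableSpace E]

lemma integral_pow_eq {π : Measure E} (hπ : ∀ f : E →ᵇ ℝ, ∫ x, P f x ∂π = ∫ x, f x ∂π)
    (k : ℕ) (f : E →ᵇ ℝ) : ∫ x, (P ^ k) f x ∂π = ∫ x, f x ∂π := by
  induction k generalizing f with
  | zero => simp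
  | succ k ih => rw [pow_succ, Module.End.mul_apply, ih, hπ]

variable [BorelSpace E]

lemma pow_tailFun_le (hP : IsMarkovOp P) (hL : PreservesLipschitz P) {π : Measure E}
    [IsProbabilityMeasure π] (hπ : ∀ f : E →ᵇ ℝ, ∫ x, P f x ∂π = ∫ x, f x ∂π) (R k : ℕ) (x : E) :
    (P ^ k) (tailFun E R) x ≤ 2 * ∫ y, tailFun E R y ∂π + tailFun E R x := by
  have h := integral_mono (μ := π) (integrable_const ((P ^ k) (tailFun E R) x))
    (((((P ^ k) (tailFun E R)).integrable π).add (integrable_const (tailFun E R x))).add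
      ((tailFun E R).integrable π)) (fun y => pow_tailFun_le_add hP hL R k x y)
  rw [integral_add' ((((P ^ k) (tailFun E R)).integrable π).add (integrable_const _))
    ((tailFun E R).integrable π), integral_add' (((P ^ k) (tailFun E R)).integrable π)
    (integrable_const _), integral_pow_eq hπ] at h
  simp only [integral_const, probReal_univ, smul_eq_mul, one_mul] at h
  linarith

lemma orbitTight_of_invariant (hP : IsMarkovOp P) (hL : PreservesLipschitz P) {π : Measure E}
    [IsProbabilityMeasure π] (hπ : ∀ f : E →ᵇ ℝ, ∫ x, P f x ∂π = ∫ x, f x ∂π) :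
    OrbitTight P := by
  intro x ε hε
  have h : Tendsto (fun R => 2 * ∫ y, tailFun E R y ∂π + tailFun E R x) atTop (𝓝 0) := by
    simpa using ((tendsto_integral_tailFun π).const_mul 2).add (tendsto_tailFun x)
  obtain ⟨R, hR⟩ := (h.eventually (gt_mem_nhds hε)).exists
  exact ⟨R, fun k => (pow_tailFun_le hP hL hπ R k x).trans hR.le⟩

end orbits

/-- Uniform convergence on bounded sets. -/
def TendstoOnBounded {E : Type*} [NormedAddCommGroup E] (f : ℕ → E →ᵇ ℝ) (h : E →ᵇ ℝ) : Prop :=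
  ∀ (R : ℕ) (ε : ℝ), 0 < ε → ∀ᶠ j in atTop, ∀ x : E, ‖x‖ ≤ R + 1 → |f j x - h x| ≤ ε

section compactness

variable {E : Type*} [NormedAddCommGroup E]

lemma TendstoOnBounded.tendsto_apply {f : ℕ → E →ᵇ ℝ} {h : E →ᵇ ℝ} (hf : TendstoOnBounded f h)
    (x : E) : Tendsto (fun j => f j x) atTop (𝓝 (h x)) := by
  obtain ⟨R, hR⟩ := exists_nat_ge ‖x‖
  refine Metric.tendsto_nhds.2 fun ε hε => ?_
  filter_upwards [hf R (ε / 2) (by positivity)] with j hj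
  rw [Real.dist_eq]
  linarith [hj x (by linarith)]

lemma TendstoOnBounded.eventually_le {f : ℕ → E →ᵇ ℝ} {h : E →ᵇ ℝ} (hf : TendstoOnBounded f h)
    {M : ℝ} (hfM : ∀ j x, |f j x| ≤ M) (hhM : ∀ x, |h x| ≤ M) (R : ℕ) {ε : ℝ} (hε : 0 < ε) :
    ∀ᶠ j in atTop, ∀ x, |(f j - h) x| ≤ ε + 2 * M * tailFun E R x := by
  filter_upwards [hf R ε hε] with j hj x
  rw [BoundedContinuousFunction.sub_apply]
  have hM : 0 ≤ M := (abs_nonneg _).trans (hhM 0)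
  rcases le_total ‖x‖ (R + 1) with hx | hx
  · have := hj x hx
    have := mul_nonneg hM (tailFun_nonneg R x)
    linarith
  · rw [tailFun_eq_one hx]
    have := abs_sub (f j x) (h x)
    linarith [hfM j x, hhM x]

lemma TendstoOnBounded.tendsto_markov {f : ℕ → E →ᵇ ℝ} {h : E →ᵇ ℝ} (hf : TendstoOnBounded f h)
    {M : ℝ} (hfM : ∀ j x, |f j x| ≤ M) (hhM : ∀ x, |h x| ≤ M) {P : (E →ᵇ ℝ) →ₗ[ℝ] (E →ᵇ ℝ)}
    (hP : IsMarkovOp P) (ht : OrbitTight P) (x : E) :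
    Tendsto (fun j => P (f j) x) atTop (𝓝 (P h x)) := by
  have hM : 0 ≤ M := (abs_nonneg _).trans (hhM 0)
  refine Metric.tendsto_nhds.2 fun ε hε => ?_
  obtain ⟨R, hR⟩ := ht x (ε / (4 * (M + 1))) (by positivity)
  have hR1 := hR 1
  rw [pow_one] at hR1
  filter_upwards [hf.eventually_le hfM hhM R (ε := ε / 4) (by positivity)] with j hj
  have h1 := hP.abs_le_add_mul hj x
  rw [map_sub, BoundedContinuousFunction.sub_apply] at h1
  rw [Real.dist_eq]
  have h2 : 2 * M * P (tailFun E R) x ≤ 2 * M * (ε / (4 * (M + 1))) := by gcongr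
  have h3 : 2 * M * (ε / (4 * (M + 1))) ≤ ε / 2 := by
    rw [mul_div_assoc', div_le_div_iff₀ (by positivity) (by positivity)]
    nlinarith
  linarith

lemma exists_subseq_tendstoOnBounded [ProperSpace E] (f : ℕ → E →ᵇ ℝ) {M L : ℝ}
    (hM : ∀ k x, |f k x| ≤ M) (hL : ∀ k x y, |f k x - f k y| ≤ L * ‖x - y‖) :
    ∃ φ : ℕ → ℕ, StrictMono φ ∧ ∃ h : E →ᵇ ℝ, (∀ x, |h x| ≤ M) ∧
      TendstoOnBounded (fun j => f (φ j)) h := by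
  set S : Set C(E, ℝ) :=
    {g | (∀ x, g x ∈ Set.Icc (-M) M) ∧ ∀ x y, |g x - g y| ≤ L * ‖x - y‖} with hS
  have himage : ContinuousMap.toFun '' S =
      Set.univ.pi (fun _ : E => Set.Icc (-M) M) ∩ ⋂ x, ⋂ y, {g | |g x - g y| ≤ L * ‖x - y‖} := by
    ext g
    simp only [Set.mem_image, Set.mem_inter_iff, Set.mem_univ_pi, Set.mem_iInter,
      Set.mem_ofPred_eq]
    constructor
    · rintro ⟨g, hg, rfl⟩
      exact hg
    · intro hg
      have hcont : Continuous g := (LipschitzWith.of_dist_le_mul (K := L.toNNReal) fun x y => by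
        rw [Real.dist_eq, dist_eq_norm]
        exact (hg.2 x y).trans (by gcongr; exact Real.le_coe_toNNReal L)).continuous
      exact ⟨⟨g, hcont⟩, hg, rfl⟩
  have hcpt : IsCompact S := by
    refine ArzelaAscoli.isCompact_of_equicontinuous S ?_ ?_
    · rw [himage]
      refine (isCompact_univ_pi fun _ => isCompact_Icc).inter_right ?_
      refine isClosed_iInter fun x => isClosed_iInter fun y => isClosed_le ?_ continuous_const
      fun_prop
    · intro x
      refine Metric.equicontinuousAt_of_continuity_modulus (fun y => L * ‖x - y‖) ?_ _ ?_
      · have : Continuous fun y => L * ‖x - y‖ := by fun_prop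
        simpa using this.tendsto x
      · exact Eventually.of_forall fun y g => by
          rw [Real.dist_eq]
          exact g.2.2 x y
  obtain ⟨h, -, φ, hφ, hlim⟩ := hcpt.tendsto_subseq (x := fun k => (f k : C(E, ℝ)))
    fun k => ⟨fun x => abs_le.1 (hM k x), hL k⟩
  have hpt : ∀ x, Tendsto (fun j => f (φ j) x) atTop (𝓝 (h x)) := fun x =>
    ((continuous_eval_const x).tendsto h).comp hlim
  have hhM : ∀ x, |h x| ≤ M := fun x =>
    le_of_tendsto (hpt x).abs (Eventually.of_forall fun j => hM _ x)
  refine ⟨φ, hφ, BoundedContinuousFunction.ofNormedAddCommGroup h h.continuous M hhM, hhM, ?_⟩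
  intro R ε hε
  have := (ContinuousMap.tendsto_iff_forall_isCompact_tendstoUniformlyOn.1 hlim)
    (Metric.closedBall 0 (R + 1)) (isCompact_closedBall _ _)
  filter_upwards [Metric.tendstoUniformlyOn_iff.1 this ε hε] with j hj x hx
  have := (hj x (by simpa using hx)).le
  rw [dist_comm, Real.dist_eq] at this
  exact this

end compactness

section invariant

variable {E : Type*} [NormedAddCommGroup E] {P : (E →ᵇ ℝ) →ₗ[ℝ] (E →ᵇ ℝ)}

/-- Cesàro means of the orbit of a bounded Lipschitz function have an invariant limit point. -/
lemma exists_invariant_function [ProperSpace E] (hP : IsMarkovOp P) (hL : PreservesLipschitz P)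
    (ht : OrbitTight P) (f : E →ᵇ ℝ) {L : ℝ} (hf : ∀ x y, |f x - f y| ≤ L * ‖x - y‖) :
    ∃ h : E →ᵇ ℝ, P h = h ∧
      ∀ x y δ, (∀ k, δ ≤ (P ^ k) f y - (P ^ k) f x) → δ ≤ h y - h x := by
  set a : ℕ → E →ᵇ ℝ := fun K => ((K : ℝ) + 1)⁻¹ • ∑ k ∈ Finset.range (K + 1), (P ^ k) f with ha
  have ha_apply : ∀ K x, a K x = ((K : ℝ) + 1)⁻¹ * ∑ k ∈ Finset.range (K + 1), (P ^ k) f x := by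
    intro K x
    simp [ha]
  have hmean : ∀ (K : ℕ) (c : ℝ),
      ((K : ℝ) + 1)⁻¹ * ∑ _k ∈ Finset.range (K + 1), c = c := by
    intro K c
    have : (K : ℝ) + 1 ≠ 0 := by positivity
    simp [this]
  have hfM : ∀ k x, |(P ^ k) f x| ≤ ‖f‖ := fun k x => (hP.pow k).abs_le f.norm_coe_le_norm x
  have haM : ∀ K x, |a K x| ≤ ‖f‖ := by
    intro K x
    rw [ha_apply, abs_mul, abs_of_pos (by positivity : (0 : ℝ) < ((K : ℝ) + 1)⁻¹)]
    refine le_trans ?_ (hmean K ‖f‖).le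
    gcongr
    exact (Finset.abs_sum_le_sum_abs _ _).trans (Finset.sum_le_sum fun k _ => hfM k x)
  have haL : ∀ K x y, |a K x - a K y| ≤ L * ‖x - y‖ := by
    intro K x y
    rw [ha_apply, ha_apply, ← mul_sub, ← Finset.sum_sub_distrib, abs_mul,
      abs_of_pos (by positivity : (0 : ℝ) < ((K : ℝ) + 1)⁻¹)]
    refine le_trans ?_ (hmean K (L * ‖x - y‖)).le
    gcongr
    exact (Finset.abs_sum_le_sum_abs _ _).trans
      (Finset.sum_le_sum fun k _ => hL.pow k L f hf x y)
  have hPa : ∀ K x, P (a K) x = a K x + ((K : ℝ) + 1)⁻¹ * ((P ^ (K + 1)) f x - f x) := by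
    intro K x
    have h1 : P (a K) = ((K : ℝ) + 1)⁻¹ • ∑ k ∈ Finset.range (K + 1), (P ^ (k + 1)) f := by
      simp only [ha, map_smul, map_sum, pow_succ', Module.End.mul_apply]
    have h2 := Finset.sum_range_succ' (fun k => (P ^ k) f x) (K + 1)
    rw [Finset.sum_range_succ] at h2
    rw [h1, ha_apply]
    simp only [BoundedContinuousFunction.coe_smul, BoundedContinuousFunction.coe_sum,
      Finset.sum_apply, smul_eq_mul]
    rw [← mul_add]
    congr 1
    simp only [pow_zero, Module.End.one_apply] at h2
    linarith
  obtain ⟨φ, hφ, h, hhM, hlim⟩ := exists_subseq_tendstoOnBounded a haM haL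
  refine ⟨h, ?_, ?_⟩
  · ext x
    refine tendsto_nhds_unique
      (hlim.tendsto_markov (fun j x => haM (φ j) x) hhM hP ht x) ?_
    have hz : Tendsto (fun K : ℕ => ((K : ℝ) + 1)⁻¹ * ((P ^ (K + 1)) f x - f x)) atTop (𝓝 0) := by
      have h0 : Tendsto (fun K : ℕ => ((K : ℝ) + 1)⁻¹ * (2 * ‖f‖)) atTop (𝓝 0) := by
        simpa using (tendsto_one_div_add_atTop_nhds_zero_nat (𝕜 := ℝ)).mul_const (2 * ‖f‖)
      refine squeeze_zero_norm (fun K => ?_) h0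
      rw [Real.norm_eq_abs, abs_mul, abs_of_pos (by positivity : (0 : ℝ) < ((K : ℝ) + 1)⁻¹)]
      gcongr
      have := abs_sub ((P ^ (K + 1)) f x) (f x)
      have := hfM (K + 1) x
      have := f.norm_coe_le_norm x
      rw [Real.norm_eq_abs] at this
      linarith
    have := (hlim.tendsto_apply x).add (hz.comp hφ.tendsto_atTop)
    simpa [hPa, Function.comp_def] using this
  · intro x y δ hδ
    refine ge_of_tendsto ((hlim.tendsto_apply y).sub (hlim.tendsto_apply x))
      (Eventually.of_forall fun j => ?_)
    simp only [ha_apply]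
    rw [← mul_sub, ← Finset.sum_sub_distrib]
    refine (hmean (φ j) δ).symm.le.trans ?_
    gcongr
    exact hδ _

/-- A positive function has averages along an orbit bounded away from zero. -/
lemma exists_pos_le_pow [ProperSpace E] (hP : IsMarkovOp P) (ht : OrbitTight P) (w : E →ᵇ ℝ)
    (hw : ∀ x, 0 < w x) (x : E) : ∃ δ > 0, ∀ k, δ ≤ (P ^ k) w x := by
  obtain ⟨R, hR⟩ := ht x (1 / 2) (by norm_num)
  obtain ⟨z, -, hz⟩ := (isCompact_closedBall (0 : E) (R + 1)).exists_isMinOn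
    ⟨0, by simp; positivity⟩ w.continuous.continuousOn
  refine ⟨w z / 2, half_pos (hw z), fun k => ?_⟩
  have h1 : ∀ y, (-w) y ≤ -w z + w z * tailFun E R y := by
    intro y
    rw [BoundedContinuousFunction.coe_neg, Pi.neg_apply]
    rcases le_total ‖y‖ (R + 1) with hy | hy
    · have := isMinOn_iff.1 hz y (by simpa using hy)
      have := mul_nonneg (hw z).le (tailFun_nonneg R y)
      linarith
    · rw [tailFun_eq_one hy]
      linarith [hw y]
  have h2 := (hP.pow k).le_add_mul h1 x
  have h3 := mul_le_mul_of_nonneg_left (hR k) (hw z).le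
  rw [map_neg, BoundedContinuousFunction.coe_neg, Pi.neg_apply] at h2
  linarith

lemma IsMarkovOp.sq_sub_apply {X Y : Type*} [TopologicalSpace X] [TopologicalSpace Y]
    {A : (Y →ᵇ ℝ) →ₗ[ℝ] (X →ᵇ ℝ)} (hA : IsMarkovOp A) (h : Y →ᵇ ℝ) (c : ℝ) (x : X) :
    A ((h - c • 1) * (h - c • 1)) x = A (h * h) x - 2 * c * A h x + c ^ 2 := by
  have : (h - c • 1) * (h - c • 1) = h * h - (2 * c) • h + (c ^ 2) • (1 : Y →ᵇ ℝ) := by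
    ext y
    simp
    ring
  rw [this, map_add, map_sub, map_smul, map_smul, hA.one]
  simp

lemma pow_apply_of_invariant {E : Type*} [TopologicalSpace E]
    {P : (E →ᵇ ℝ) →ₗ[ℝ] (E →ᵇ ℝ)} {h : E →ᵇ ℝ} (hh : P h = h) (k : ℕ) : (P ^ k) h = h := by
  induction k with
  | zero => simp
  | succ k ih => rw [pow_succ, Module.End.mul_apply, hh, ih]

lemma monotone_pow_sq (hP : IsMarkovOp P) {h : E →ᵇ ℝ} (hh : P h = h) (x : E) :
    Monotone fun m => (P ^ m) (h * h) x := by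
  refine monotone_nat_of_le_succ fun m => ?_
  rw [pow_succ, Module.End.mul_apply]
  refine (hP.pow m).mono (fun y => ?_) x
  have h1 := hP.sq_sub_apply h (h y) y
  have h2 := hP.nonneg ((h - h y • 1) * (h - h y • 1)) (fun z => mul_self_nonneg _) y
  rw [h1, hh] at h2
  rw [BoundedContinuousFunction.mul_apply]
  linarith

lemma exists_tendsto_pow_sq (hP : IsMarkovOp P) {h : E →ᵇ ℝ} (hh : P h = h) (x : E) :
    ∃ l, Tendsto (fun m => (P ^ m) (h * h) x) atTop (𝓝 l) :=
  ⟨_, tendsto_atTop_ciSup (monotone_pow_sq hP hh x)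
    ⟨‖h * h‖, by
      rintro _ ⟨m, rfl⟩
      exact (le_abs_self _).trans ((hP.pow m).abs_le (h * h).norm_coe_le_norm x)⟩⟩

end invariant

/-- A function of the first coordinate, viewed on the product. -/
def fstFun {E : Type*} [TopologicalSpace E] (f : E →ᵇ ℝ) : E × E →ᵇ ℝ :=
  f.compContinuous ⟨Prod.fst, continuous_fst⟩

/-- A function of the second coordinate, viewed on the product. -/
def sndFun {E : Type*} [TopologicalSpace E] (f : E →ᵇ ℝ) : E × E →ᵇ ℝ :=
  f.compContinuous ⟨Prod.snd, continuous_snd⟩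

@[simp] lemma fstFun_apply {E : Type*} [TopologicalSpace E] (f : E →ᵇ ℝ) (p : E × E) :
    fstFun f p = f p.1 := rfl

@[simp] lemma sndFun_apply {E : Type*} [TopologicalSpace E] (f : E →ᵇ ℝ) (p : E × E) :
    sndFun f p = f p.2 := rfl

/-- The squared difference of the values of a function at two points. -/
def diffSq {E : Type*} [TopologicalSpace E] (h : E →ᵇ ℝ) : E × E →ᵇ ℝ :=
  (fstFun h - sndFun h) * (fstFun h - sndFun h)

lemma diffSq_apply {E : Type*} [TopologicalSpace E] (h : E →ᵇ ℝ) (p : E × E) :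
    diffSq h p = (h p.1 - h p.2) ^ 2 := by
  simp [diffSq, sq]

/-- `Q` couples two copies of the chain with operator `P`, and `N` runs one step of the chain,
keeping the starting point as first coordinate. -/
structure IsCoupling {E : Type*} [TopologicalSpace E] (P : (E →ᵇ ℝ) →ₗ[ℝ] (E →ᵇ ℝ))
    (Q : (E × E →ᵇ ℝ) →ₗ[ℝ] (E × E →ᵇ ℝ)) (N : (E × E →ᵇ ℝ) →ₗ[ℝ] (E →ᵇ ℝ)) : Prop where
  markov : IsMarkovOp P
  markov_pair : IsMarkovOp Q
  markov_init : IsMarkovOp N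
  fst : ∀ f, Q (fstFun f) = fstFun (P f)
  snd : ∀ f, Q (sndFun f) = sndFun (P f)
  init_mul : ∀ f g, N (fstFun f * sndFun g) = f * P g

namespace IsCoupling

variable {E : Type*} [TopologicalSpace E] {P : (E →ᵇ ℝ) →ₗ[ℝ] (E →ᵇ ℝ)}
  {Q : (E × E →ᵇ ℝ) →ₗ[ℝ] (E × E →ᵇ ℝ)} {N : (E × E →ᵇ ℝ) →ₗ[ℝ] (E →ᵇ ℝ)}

lemma pow_fst (hc : IsCoupling P Q N) (k : ℕ) (f : E →ᵇ ℝ) :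
    (Q ^ k) (fstFun f) = fstFun ((P ^ k) f) := by
  induction k generalizing f with
  | zero => simp
  | succ k ih => rw [pow_succ, pow_succ, Module.End.mul_apply, Module.End.mul_apply, hc.fst, ih]

lemma pow_snd (hc : IsCoupling P Q N) (k : ℕ) (f : E →ᵇ ℝ) :
    (Q ^ k) (sndFun f) = sndFun ((P ^ k) f) := by
  induction k generalizing f with
  | zero => simp
  | succ k ih => rw [pow_succ, pow_succ, Module.End.mul_apply, Module.End.mul_apply, hc.snd, ih]

lemma init_fst (hc : IsCoupling P Q N) (f : E →ᵇ ℝ) : N (fstFun f) = f := by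
  have h := hc.init_mul f 1
  rwa [hc.markov.one, mul_one, show sndFun (1 : E →ᵇ ℝ) = 1 from rfl, mul_one] at h

lemma init_snd (hc : IsCoupling P Q N) (f : E →ᵇ ℝ) : N (sndFun f) = P f := by
  have h := hc.init_mul 1 f
  rwa [one_mul, show fstFun (1 : E →ᵇ ℝ) = 1 from rfl, one_mul] at h

lemma init_diffSq (hc : IsCoupling P Q N) {h : E →ᵇ ℝ} (hh : P h = h) :
    N (diffSq h) = P (h * h) - h * h := by
  have : diffSq h = fstFun (h * h) + sndFun (h * h) - (2 : ℝ) • (fstFun h * sndFun h) := by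
    ext p
    simp [diffSq]
    ring
  rw [this, map_sub, map_add, map_smul, hc.init_fst, hc.init_snd, hc.init_mul, hh]
  ext x
  simp
  ring

lemma pow_diffSq_le (hc : IsCoupling P Q N) {h : E →ᵇ ℝ} (hh : P h = h) (k : ℕ)
    (p : E × E) : (Q ^ k) (diffSq h) p ≤
      ((3 : ℝ) • (fstFun ((P ^ k) (h * h) - h * h) + diffSq h +
        sndFun ((P ^ k) (h * h) - h * h))) p := by
  obtain ⟨c, hcp⟩ : ∃ c, c = h p.1 := ⟨_, rfl⟩
  obtain ⟨d, hdp⟩ : ∃ d, d = h p.2 := ⟨_, rfl⟩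
  have hQ := hc.markov_pair.pow k
  have h1 := hQ.mono (f := diffSq h) (g := (3 : ℝ) • (fstFun ((h - c • 1) * (h - c • 1)) +
    ((c - d) ^ 2) • 1 + sndFun ((h - d • 1) * (h - d • 1)))) (fun q => by
      simp only [diffSq_apply, BoundedContinuousFunction.coe_smul,
        BoundedContinuousFunction.add_apply, fstFun_apply, sndFun_apply,
        BoundedContinuousFunction.mul_apply, BoundedContinuousFunction.sub_apply,
        BoundedContinuousFunction.coe_one, Pi.one_apply, smul_eq_mul, mul_one]
      nlinarith [sq_nonneg ((h q.1 - c) - (c - d)), sq_nonneg ((h q.1 - c) + (h q.2 - d)),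
        sq_nonneg ((c - d) + (h q.2 - d))]) p
  refine h1.trans_eq ?_
  rw [map_smul, map_add, map_add, map_smul, hQ.one, hc.pow_fst, hc.pow_snd]
  simp only [diffSq_apply, BoundedContinuousFunction.coe_smul,
    BoundedContinuousFunction.add_apply, fstFun_apply, sndFun_apply,
    BoundedContinuousFunction.mul_apply, BoundedContinuousFunction.sub_apply,
    BoundedContinuousFunction.coe_one, Pi.one_apply, smul_eq_mul, mul_one,
    (hc.markov.pow k).sq_sub_apply, pow_apply_of_invariant hh, ← hcp, ← hdp]
  ring

/-- For an invariant function, the squared increments between two coupled copies of the chain, one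
of which is a step ahead, are controlled by the increments of the second moments. -/
lemma pow_init_pow_diffSq_le (hc : IsCoupling P Q N) {h : E →ᵇ ℝ} (hh : P h = h)
    (m k : ℕ) (x : E) :
    (P ^ m) (N ((Q ^ k) (diffSq h))) x ≤
      3 * (((P ^ (m + k)) (h * h) x - (P ^ m) (h * h) x) +
        ((P ^ (m + 1)) (h * h) x - (P ^ m) (h * h) x) +
        ((P ^ (m + 1 + k)) (h * h) x - (P ^ (m + 1)) (h * h) x)) := by
  have h1 := (hc.markov.pow m).mono (fun y => hc.markov_init.mono (hc.pow_diffSq_le hh k) y) x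
  refine h1.trans_eq ?_
  simp only [map_smul, map_add, hc.init_fst, hc.init_snd, hc.init_diffSq hh, map_sub, pow_add,
    pow_one, Module.End.mul_apply]
  simp
  ring

end IsCoupling

section regularity

variable {E : Type*} [NormedAddCommGroup E] {P : (E →ᵇ ℝ) →ₗ[ℝ] (E →ᵇ ℝ)}
  {Q : (E × E →ᵇ ℝ) →ₗ[ℝ] (E × E →ᵇ ℝ)} {N : (E × E →ᵇ ℝ) →ₗ[ℝ] (E →ᵇ ℝ)}

lemma IsMarkovOp.antitone_pow {X : Type*} [TopologicalSpace X] {A : (X →ᵇ ℝ) →ₗ[ℝ] (X →ᵇ ℝ)}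
    (hA : IsMarkovOp A) {V : X →ᵇ ℝ} (hV : ∀ p, A V p ≤ V p) (p : X) :
    Antitone fun j => (A ^ j) V p := by
  refine antitone_nat_of_succ_le fun j => ?_
  rw [pow_succ, Module.End.mul_apply]
  exact (hA.pow j).mono hV p

/-- A quantitative form of separation: on bounded sets, the function `V` is controlled by its
decrease along the coupled chain and by the increments of finitely many invariant functions. -/
lemma exists_le_add_decrement [ProperSpace E] (hQ : IsMarkovOp Q) {V : E × E →ᵇ ℝ}
    (hV1 : ∀ p, V p ≤ 1) (hQV : ∀ p, Q V p ≤ V p) {ι : Type*} [Fintype ι] (h : ι → E →ᵇ ℝ)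
    (hsep : ∀ p, (∀ j : ℕ, (Q ^ j) V p = V p) → (∀ i, h i p.1 = h i p.2) → V p = 0)
    (R : ℕ) {ε : ℝ} (hε : 0 < ε) :
    ∃ j : ℕ, ∃ C : ℝ, 0 < C ∧ ∀ p, V p ≤ (ε • 1 + fstFun (tailFun E R) + sndFun (tailFun E R) +
      C • (V - (Q ^ j) V + ∑ i, diffSq (h i)) : E × E →ᵇ ℝ) p := by
  set G : ℕ → E × E →ᵇ ℝ := fun j => V - (Q ^ j) V + ∑ i, diffSq (h i) with hG
  have hGapp : ∀ j p, G j p = V p - (Q ^ j) V p + ∑ i, (h i p.1 - h i p.2) ^ 2 := by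
    intro j p
    simp [hG, diffSq_apply]
  have hdec : ∀ j p, (Q ^ j) V p ≤ V p := fun j p => by
    simpa using hQ.antitone_pow hQV p (Nat.zero_le j)
  have hGnonneg : ∀ j p, 0 ≤ G j p := by
    intro j p
    rw [hGapp]
    have : 0 ≤ ∑ i, (h i p.1 - h i p.2) ^ 2 := Finset.sum_nonneg fun i _ => sq_nonneg _
    linarith [hdec j p]
  set K : Set (E × E) :=
    (Metric.closedBall 0 (R + 1) ×ˢ Metric.closedBall 0 (R + 1)) ∩ {p | ε ≤ V p} with hK
  have hKc : IsCompact K :=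
    ((isCompact_closedBall _ _).prod (isCompact_closedBall _ _)).inter_right
      (isClosed_le continuous_const V.continuous)
  obtain ⟨j, hj⟩ := hKc.elim_directed_cover (fun j => {p | 0 < G j p})
    (fun j => isOpen_lt continuous_const (G j).continuous)
    (by
      intro p hp
      by_contra hcon
      simp only [Set.mem_iUnion, Set.mem_ofPred_eq, not_exists, not_lt] at hcon
      have hz : ∀ j, V p - (Q ^ j) V p + ∑ i, (h i p.1 - h i p.2) ^ 2 ≤ 0 := fun j => by
        rw [← hGapp]; exact hcon j
      have hs : 0 ≤ ∑ i, (h i p.1 - h i p.2) ^ 2 := Finset.sum_nonneg fun i _ => sq_nonneg _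
      have hs0 : ∑ i, (h i p.1 - h i p.2) ^ 2 = 0 := by linarith [hz 0, hdec 0 p]
      have := hsep p (fun j => le_antisymm (hdec j p) (by linarith [hz j])) (fun i => by
        have := (Finset.sum_eq_zero_iff_of_nonneg fun i _ => sq_nonneg _).1 hs0 i
          (Finset.mem_univ i)
        exact sub_eq_zero.1 (pow_eq_zero_iff two_ne_zero |>.1 this))
      have h2 : ε ≤ V p := hp.2
      linarith)
    (directed_of_isDirected_le fun j k hjk p hp => by
      have h1 : 0 < G j p := hp
      change 0 < G k p
      rw [hGapp] at h1 ⊢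
      linarith [hQ.antitone_pow hQV p hjk])
  obtain ⟨δ, hδ, hδK⟩ : ∃ δ > 0, ∀ p ∈ K, δ ≤ G j p := by
    rcases K.eq_empty_or_nonempty with he | hne
    · exact ⟨1, one_pos, by simp [he]⟩
    · obtain ⟨z, hzK, hz⟩ := hKc.exists_isMinOn hne (G j).continuous.continuousOn
      exact ⟨G j z, hj hzK, fun p hp => isMinOn_iff.1 hz p hp⟩
  refine ⟨j, δ⁻¹, inv_pos.2 hδ, fun p => ?_⟩
  have key : V p ≤ ε + tailFun E R p.1 + tailFun E R p.2 + δ⁻¹ * G j p := by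
    have h1 := tailFun_nonneg R p.1
    have h2 := tailFun_nonneg R p.2
    have h3 := mul_nonneg (inv_pos.2 hδ).le (hGnonneg j p)
    by_cases hp1 : (R : ℝ) + 1 ≤ ‖p.1‖
    · rw [tailFun_eq_one hp1]; linarith [hV1 p]
    by_cases hp2 : (R : ℝ) + 1 ≤ ‖p.2‖
    · rw [tailFun_eq_one hp2]; linarith [hV1 p]
    by_cases hp3 : ε ≤ V p
    · have hpK : p ∈ K := by
        refine ⟨⟨?_, ?_⟩, hp3⟩
        · simpa using (not_le.1 hp1).le
        · simpa using (not_le.1 hp2).le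
      have : 1 ≤ δ⁻¹ * G j p := by
        rw [inv_mul_eq_div, one_le_div hδ]
        exact hδK p hpK
      linarith [hV1 p]
    · linarith
  refine key.trans_eq ?_
  rw [hGapp]
  simp [diffSq_apply, mul_add]

/-- Two copies of the chain driven by the same noise, one of which is a step ahead, synchronize. -/
lemma exists_init_pow_le [ProperSpace E] (hc : IsCoupling P Q N) (ht : OrbitTight P)
    {V : E × E →ᵇ ℝ} (hV0 : ∀ p, 0 ≤ V p) (hV1 : ∀ p, V p ≤ 1) (hQV : ∀ p, Q V p ≤ V p)
    {ι : Type*} [Fintype ι]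
    (h : ι → E →ᵇ ℝ) (hh : ∀ i, P (h i) = h i)
    (hsep : ∀ p, (∀ j : ℕ, (Q ^ j) V p = V p) → (∀ i, h i p.1 = h i p.2) → V p = 0)
    (x : E) {ε : ℝ} (hε : 0 < ε) :
    ∃ m k₀ : ℕ, ∀ k ≥ k₀, (P ^ m) (N ((Q ^ k) V)) x ≤ ε := by
  obtain ⟨R, hR⟩ := ht x (ε / 5) (by positivity)
  obtain ⟨j, C, hC, hdom⟩ := exists_le_add_decrement hc.markov_pair hV1 hQV h hsep R
    (ε := ε / 5) (by positivity)
  have hη : 0 < ε / 5 / C := by positivity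
  obtain ⟨m, hm⟩ : ∃ m, ∀ k : ℕ,
      ∑ i, (P ^ m) (N ((Q ^ k) (diffSq (h i)))) x ≤ ε / 5 / C := by
    choose l hl using fun i => exists_tendsto_pow_sq hc.markov (hh i) x
    have hlim : Tendsto (fun m => ∑ i, 9 * (l i - (P ^ m) (h i * h i) x)) atTop (𝓝 0) := by
      have := tendsto_finsetSum Finset.univ (fun i (_ : i ∈ Finset.univ) =>
        ((tendsto_const_nhds (x := l i)).sub (hl i)).const_mul 9)
      simpa using this
    obtain ⟨m, hm⟩ := (hlim.eventually (gt_mem_nhds hη)).exists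
    refine ⟨m, fun k => le_trans (Finset.sum_le_sum fun i _ => ?_) hm.le⟩
    have hb := hc.pow_init_pow_diffSq_le (hh i) m k x
    have hmon := monotone_pow_sq hc.markov (hh i) x
    have hle := fun a => hmon.ge_of_tendsto (hl i) a
    have h1 := hmon (Nat.le_succ m)
    simp only at h1
    linarith [hle (m + k), hle (m + 1), hle (m + 1 + k)]
  have hanti : Antitone fun k => (P ^ m) (N ((Q ^ k) V)) x := fun a b hab =>
    (hc.markov.pow m).mono (fun y => hc.markov_init.mono
      (fun p => hc.markov_pair.antitone_pow hQV p hab) y) x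
  obtain ⟨k, hk⟩ : ∃ k, (P ^ m) (N ((Q ^ k) V)) x - (P ^ m) (N ((Q ^ (k + j)) V)) x ≤
      ε / 5 / C := by
    have hbdd : BddBelow (Set.range fun k => (P ^ m) (N ((Q ^ k) V)) x) :=
      ⟨0, by
        rintro _ ⟨k, rfl⟩
        exact (hc.markov.pow m).nonneg _ (hc.markov_init.nonneg _
          ((hc.markov_pair.pow k).nonneg _ hV0)) x⟩
    have hlim := tendsto_atTop_ciInf hanti hbdd
    have hsub := hlim.sub (hlim.comp (tendsto_add_atTop_nat j))
    rw [sub_self] at hsub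
    obtain ⟨k, hk⟩ := (hsub.eventually (gt_mem_nhds hη)).exists
    exact ⟨k, hk.le⟩
  refine ⟨m, k, fun k' hk' => (hanti hk').trans ?_⟩
  have h1 := (hc.markov.pow m).mono (fun y => hc.markov_init.mono
      (fun p => (hc.markov_pair.pow k).mono hdom p) y) x
  have e1 : (Q ^ k) ((Q ^ j) V) = (Q ^ (k + j)) V := by rw [pow_add, Module.End.mul_apply]
  have e2 : (P ^ m) (P ((P ^ k) (tailFun E R))) = (P ^ (m + 1 + k)) (tailFun E R) := by
    rw [pow_add, pow_add, pow_one, Module.End.mul_apply, Module.End.mul_apply]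
  have e3 : (P ^ m) ((P ^ k) (tailFun E R)) = (P ^ (m + k)) (tailFun E R) := by
    rw [pow_add, Module.End.mul_apply]
  simp only [map_add, map_smul, map_sub, map_sum, (hc.markov_pair.pow k).one, hc.markov_init.one,
    (hc.markov.pow m).one, hc.pow_fst, hc.pow_snd, hc.init_fst, hc.init_snd, e1, e2, e3,
    BoundedContinuousFunction.add_apply, BoundedContinuousFunction.coe_smul,
    BoundedContinuousFunction.sub_apply, BoundedContinuousFunction.coe_one, Pi.one_apply,
    BoundedContinuousFunction.coe_sum, Finset.sum_apply, smul_eq_mul, mul_one] at h1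
  have h2 : C * ((P ^ m) (N ((Q ^ k) V)) x - (P ^ m) (N ((Q ^ (k + j)) V)) x +
      ∑ i, (P ^ m) (N ((Q ^ k) (diffSq (h i)))) x) ≤ C * (ε / 5 / C + ε / 5 / C) := by
    gcongr
    exact hm k
  have h3 : C * (ε / 5 / C + ε / 5 / C) = 2 * (ε / 5) := by
    field_simp
    ring
  linarith [hR (m + k), hR (m + 1 + k)]

/-- Synchronization implies asymptotic regularity of the averages. -/
lemma tendsto_pow_succ_sub (hc : IsCoupling P Q N) {V : E × E →ᵇ ℝ} {x : E}
    (hsync : ∀ ε > 0, ∃ m k₀ : ℕ, ∀ k ≥ k₀, (P ^ m) (N ((Q ^ k) V)) x ≤ ε)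
    {f : E →ᵇ ℝ} {C : ℝ} (hC : 0 ≤ C) (hf : ∀ p : E × E, |f p.2 - f p.1| ≤ C * V p) :
    Tendsto (fun k => (P ^ (k + 1)) f x - (P ^ k) f x) atTop (𝓝 0) := by
  refine Metric.tendsto_atTop.2 fun ε hε => ?_
  obtain ⟨m, k₀, hk⟩ := hsync (ε / (2 * (C + 1))) (by positivity)
  refine ⟨m + k₀, fun n hn => ?_⟩
  obtain ⟨k, rfl⟩ : ∃ k, n = m + k := ⟨n - m, by omega⟩
  have hR := ((hc.markov.pow m).comp hc.markov_init).comp (hc.markov_pair.pow k)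
  have h1 := hR.abs_le_add_mul (f := sndFun f - fstFun f) (g := V) (a := 0) (b := C)
    (fun p => by rw [zero_add]; exact hf p) x
  have h2 : C * (P ^ m) (N ((Q ^ k) V)) x ≤ C * (ε / (2 * (C + 1))) := by
    gcongr
    exact hk k (by omega)
  have h3 : C * (ε / (2 * (C + 1))) < ε := by
    rw [mul_div_assoc', div_lt_iff₀ (by positivity)]
    nlinarith
  have e1 : (P ^ m) (P ((P ^ k) f)) = (P ^ (m + k + 1)) f := by
    rw [show m + k + 1 = m + (1 + k) by omega, pow_add, pow_add, pow_one, Module.End.mul_apply,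
      Module.End.mul_apply]
  have e2 : (P ^ m) ((P ^ k) f) = (P ^ (m + k)) f := by
    rw [pow_add, Module.End.mul_apply]
  simp only [LinearMap.comp_apply, map_sub, hc.pow_fst, hc.pow_snd, hc.init_fst, hc.init_snd, e1,
    e2, BoundedContinuousFunction.sub_apply] at h1
  rw [Real.dist_eq, sub_zero]
  linarith

/-- Under asymptotic regularity, the averages of a bounded Lipschitz function converge. -/
lemma exists_tendsto_pow [ProperSpace E] (hP : IsMarkovOp P) (hL : PreservesLipschitz P)
    (ht : OrbitTight P) (f : E →ᵇ ℝ) {L : ℝ} (hf : ∀ x y, |f x - f y| ≤ L * ‖x - y‖)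
    (hreg : ∀ x, Tendsto (fun k => (P ^ (k + 1)) f x - (P ^ k) f x) atTop (𝓝 0)) :
    ∃ g : E →ᵇ ℝ, ∀ x, Tendsto (fun k => (P ^ k) f x) atTop (𝓝 (g x)) := by
  have hfM : ∀ k x, |(P ^ k) f x| ≤ ‖f‖ := fun k x => (hP.pow k).abs_le f.norm_coe_le_norm x
  obtain ⟨φ, hφ, g, hgM, hlim⟩ := exists_subseq_tendstoOnBounded (fun k => (P ^ k) f) hfM
    (fun k => hL.pow k L f hf)
  have hg : P g = g := by
    ext x
    refine tendsto_nhds_unique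
      (hlim.tendsto_markov (fun j x => hfM (φ j) x) hgM hP ht x) ?_
    have := (hlim.tendsto_apply x).add ((hreg x).comp hφ.tendsto_atTop)
    simpa [pow_succ', Function.comp_def] using this
  refine ⟨g, fun x => Metric.tendsto_atTop.2 fun ε hε => ?_⟩
  obtain ⟨R, hR⟩ := ht x (ε / (8 * (‖f‖ + 1))) (by positivity)
  obtain ⟨j, hj⟩ := (hlim.eventually_le (fun j x => hfM (φ j) x) hgM R
    (ε := ε / 4) (by positivity)).exists
  refine ⟨φ j, fun n hn => ?_⟩
  obtain ⟨k, rfl⟩ : ∃ k, n = k + φ j := ⟨n - φ j, by omega⟩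
  have h1 := (hP.pow k).abs_le_add_mul hj x
  rw [map_sub, pow_apply_of_invariant hg, ← Module.End.mul_apply, ← pow_add,
    BoundedContinuousFunction.sub_apply] at h1
  have h2 : 2 * ‖f‖ * (P ^ k) (tailFun E R) x ≤ 2 * ‖f‖ * (ε / (8 * (‖f‖ + 1))) := by
    gcongr
    exact hR k
  have h3 : 2 * ‖f‖ * (ε / (8 * (‖f‖ + 1))) ≤ ε / 4 := by
    rw [mul_div_assoc', div_le_div_iff₀ (by positivity) (by positivity)]
    nlinarith [norm_nonneg f]
  rw [Real.dist_eq]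
  linarith

end regularity

section measures

variable {E : Type*} [NormedAddCommGroup E] [ProperSpace E] [MeasurableSpace E] [BorelSpace E]
  {P : (E →ᵇ ℝ) →ₗ[ℝ] (E →ᵇ ℝ)}

lemma isTightMeasureSet_of_integral_pow (hP : IsMarkovOp P) (hL : PreservesLipschitz P)
    {π : Measure E} [IsProbabilityMeasure π] (hπ : ∀ f : E →ᵇ ℝ, ∫ x, P f x ∂π = ∫ x, f x ∂π)
    {μ₀ : Measure E} [IsProbabilityMeasure μ₀] {μ : ℕ → ProbabilityMeasure E}
    (hμ : ∀ k (f : E →ᵇ ℝ), ∫ x, f x ∂(μ k : Measure E) = ∫ x, (P ^ k) f x ∂μ₀) :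
    IsTightMeasureSet {((ν : ProbabilityMeasure E) : Measure E) | ν ∈ Set.range μ} := by
  refine isTightMeasureSet_iff_exists_isCompact_measure_compl_le.2 fun ε hε => ?_
  rcases eq_or_ne ε ⊤ with rfl | hεt
  · exact ⟨∅, isCompact_empty, fun _ _ => le_top⟩
  have hε' : 0 < ε.toReal := ENNReal.toReal_pos hε.ne' hεt
  have hlim : Tendsto (fun R => 2 * ∫ y, tailFun E R y ∂π + ∫ y, tailFun E R y ∂μ₀) atTop
      (𝓝 0) := by
    simpa using ((tendsto_integral_tailFun π).const_mul 2).add (tendsto_integral_tailFun μ₀)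
  obtain ⟨R, hR⟩ := (hlim.eventually (gt_mem_nhds hε')).exists
  refine ⟨Metric.closedBall 0 (R + 1), isCompact_closedBall _ _, ?_⟩
  rintro _ ⟨_, ⟨k, rfl⟩, rfl⟩
  have hmeas : MeasurableSet (Metric.closedBall (0 : E) (R + 1))ᶜ :=
    Metric.isClosed_closedBall.measurableSet.compl
  have h1 : (μ k : Measure E).real (Metric.closedBall (0 : E) (R + 1))ᶜ ≤
      ∫ x, tailFun E R x ∂(μ k : Measure E) := by
    rw [← integral_indicator_one hmeas]
    refine integral_mono ((integrable_const (1 : ℝ)).indicator hmeas) ((tailFun E R).integrable _)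
      fun x => ?_
    by_cases hx : x ∈ Metric.closedBall (0 : E) (R + 1)
    · simpa [hx] using tailFun_nonneg R x
    · rw [Set.indicator_of_mem (show x ∈ _ᶜ from hx), tailFun_eq_one]
      · simp
      · simpa using (not_le.1 (fun h => hx (mem_closedBall_zero_iff.2 h))).le
  have h2 : ∫ x, tailFun E R x ∂(μ k : Measure E) ≤
      2 * ∫ y, tailFun E R y ∂π + ∫ y, tailFun E R y ∂μ₀ := by
    rw [hμ]
    refine (integral_mono (((P ^ k) (tailFun E R)).integrable μ₀)
      ((integrable_const (2 * ∫ y, tailFun E R y ∂π)).add ((tailFun E R).integrable μ₀))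
      (fun x => pow_tailFun_le hP hL hπ R k x)).trans_eq ?_
    rw [integral_add' (integrable_const _) ((tailFun E R).integrable μ₀)]
    simp
  rw [← ENNReal.ofReal_toReal hεt, ← ENNReal.ofReal_toReal (measure_ne_top (μ k : Measure E) _)]
  exact ENNReal.ofReal_le_ofReal ((h1.trans h2).trans hR.le)

/-- If the averages of bounded Lipschitz functions converge pointwise and there is an invariant
probability measure, then the laws of the chain converge weakly to an invariant law. -/
lemma exists_tendsto_of_tendsto_pow (hP : IsMarkovOp P) (hL : PreservesLipschitz P)
    {π : Measure E} [IsProbabilityMeasure π] (hπ : ∀ f : E →ᵇ ℝ, ∫ x, P f x ∂π = ∫ x, f x ∂π)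
    {μ₀ : Measure E} [IsProbabilityMeasure μ₀] {μ : ℕ → ProbabilityMeasure E}
    (hμ : ∀ k (f : E →ᵇ ℝ), ∫ x, f x ∂(μ k : Measure E) = ∫ x, (P ^ k) f x ∂μ₀)
    (hconv : ∀ (f : E →ᵇ ℝ) (L : ℝ), (∀ x y, |f x - f y| ≤ L * ‖x - y‖) →
      ∃ g : E →ᵇ ℝ, ∀ x, Tendsto (fun k => (P ^ k) f x) atTop (𝓝 (g x))) :
    ∃ ρ : ProbabilityMeasure E,
      (∀ f : E →ᵇ ℝ, ∫ x, P f x ∂(ρ : Measure E) = ∫ x, f x ∂(ρ : Measure E)) ∧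
      ∀ f : E →ᵇ ℝ, Tendsto (fun k => ∫ x, f x ∂(μ k : Measure E)) atTop
        (𝓝 (∫ x, f x ∂(ρ : Measure E))) := by
  have hcomp : IsCompact (closure (Set.range μ)) :=
    isCompact_closure_of_isTightMeasureSet (isTightMeasureSet_of_integral_pow hP hL hπ hμ)
  obtain ⟨ρ, -, hρ : Tendsto μ (hyperfilter ℕ : Filter ℕ) (𝓝 ρ)⟩ :=
    hcomp.ultrafilter_le_nhds ((hyperfilter ℕ).map μ) (by
      refine le_principal_iff.2 (mem_map.2 (Eventually.of_forall fun k => ?_))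
      exact subset_closure ⟨k, rfl⟩)
  rw [ProbabilityMeasure.tendsto_iff_forall_integral_tendsto] at hρ
  have hfull : Tendsto μ atTop (𝓝 ρ) := by
    refine tendsto_iff_forall_lipschitz_integral_tendsto.2 ?_
    rintro f ⟨C, hC⟩ ⟨L, hLf⟩
    set F : E →ᵇ ℝ := BoundedContinuousFunction.mkOfBound ⟨f, hLf.continuous⟩ C hC with hF
    obtain ⟨g, hg⟩ := hconv F L (fun x y => by
      rw [← Real.dist_eq, ← dist_eq_norm]
      exact hLf.dist_le_mul x y)
    have hintegral : Tendsto (fun k => ∫ x, F x ∂(μ k : Measure E)) atTop (𝓝 (∫ x, g x ∂μ₀)) := by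
      simp only [hμ]
      exact tendsto_integral_of_dominated_convergence (fun _ => ‖F‖)
        (fun k => ((P ^ k) F).continuous.measurable.aestronglyMeasurable) (integrable_const _)
        (fun k => Eventually.of_forall fun x => (hP.pow k).abs_le F.norm_coe_le_norm x)
        (Eventually.of_forall hg)
    have heq := tendsto_nhds_unique (hρ F)
      (hintegral.mono_left ((hyperfilter_le_cofinite (α := ℕ)).trans_eq Nat.cofinite_eq_atTop))
    change Tendsto (fun k => ∫ x, F x ∂(μ k : Measure E)) atTop (𝓝 (∫ x, F x ∂(ρ : Measure E)))
    rwa [heq]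
  rw [ProbabilityMeasure.tendsto_iff_forall_integral_tendsto] at hfull
  refine ⟨ρ, fun f => ?_, hfull⟩
  refine tendsto_nhds_unique (hfull (P f)) ?_
  have hsucc : ∀ k, ∫ x, P f x ∂(μ k : Measure E) = ∫ x, f x ∂(μ (k + 1) : Measure E) :=
    fun k => by rw [hμ, hμ, pow_succ, Module.End.mul_apply]
  simp only [hsucc]
  exact (hfull f).comp (tendsto_add_atTop_nat 1)

end measures

section step

variable {G I : Type*} [MeasurableSpace G] [MeasurableSpace I] {μξ : Measure I}
  [IsProbabilityMeasure μξ] {T : I → G → G} (hΦ : Measurable fun p : G × I => T p.2 p.1)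

include hΦ

lemma markovStep_eq_map (μ : Measure G) [SFinite μ] :
    markovStep μξ T μ = (μ.prod μξ).map fun p => T p.2 p.1 := by
  have hmap : ∀ x, Measurable fun i => T i x := fun x => hΦ.comp measurable_prodMk_left
  have hk : Measurable fun x => μξ.map fun i => T i x := by
    refine Measure.measurable_of_measurable_coe _ fun s hs => ?_
    simp only [Measure.map_apply (hmap _) hs]
    exact measurable_measure_prodMk_left (hΦ hs)
  ext s hs
  rw [markovStep, Measure.bind_apply hs hk.aemeasurable, Measure.map_apply hΦ hs,
    Measure.prod_apply (hΦ hs)]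
  simp only [Measure.map_apply (hmap _) hs]
  rfl

lemma isProbabilityMeasure_markovStep_s10 (μ : Measure G) [IsProbabilityMeasure μ] :
    IsProbabilityMeasure (markovStep μξ T μ) := by
  rw [markovStep_eq_map hΦ]
  exact Measure.isProbabilityMeasure_map hΦ.aemeasurable

lemma isProbabilityMeasure_markovStep_iterate_s10 (μ : Measure G) [IsProbabilityMeasure μ] (k : ℕ) :
    IsProbabilityMeasure ((markovStep μξ T)^[k] μ) := by
  induction k with
  | zero => assumption
  | succ k ih =>
    rw [Function.iterate_succ_apply']
    exact isProbabilityMeasure_markovStep_s10 hΦ _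

variable [TopologicalSpace G] [FirstCountableTopology G] [OpensMeasurableSpace G]
  (hm : ∀ x, Measurable fun i => T i x) (hc : ∀ i, Continuous (T i))

lemma integral_markovStep_s10 (μ : Measure G) [IsProbabilityMeasure μ] (f : G →ᵇ ℝ) :
    ∫ x, f x ∂(markovStep μξ T μ) = ∫ x, avgOp μξ T hm hc f x ∂μ := by
  rw [markovStep_eq_map hΦ, integral_map hΦ.aemeasurable
    f.continuous.measurable.aestronglyMeasurable,
    integral_prod _ (integrable_bcf_comp f hΦ)]
  rfl

lemma integral_markovStep_iterate (μ : Measure G) [IsProbabilityMeasure μ] (k : ℕ) (f : G →ᵇ ℝ) :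
    ∫ x, f x ∂((markovStep μξ T)^[k] μ) = ∫ x, ((avgOp μξ T hm hc) ^ k) f x ∂μ := by
  induction k generalizing f with
  | zero => simp
  | succ k ih =>
    have := isProbabilityMeasure_markovStep_iterate_s10 hΦ (μξ := μξ) μ k
    rw [Function.iterate_succ_apply', integral_markovStep_s10 hΦ hm hc, ih, pow_succ,
      Module.End.mul_apply]

end step

/-- The distance of the two components, rescaled to be less than one. -/
noncomputable def sepFun (E : Type*) [NormedAddCommGroup E] : E × E →ᵇ ℝ :=
  BoundedContinuousFunction.ofNormedAddCommGroup (fun p => ‖p.1 - p.2‖ / (1 + ‖p.1 - p.2‖))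
    (Continuous.div (by fun_prop) (by fun_prop) fun p => by positivity) 1
    (fun p => by
      rw [Real.norm_of_nonneg (by positivity), div_le_one (by positivity)]
      linarith)

section sepFun

variable {E : Type*} [NormedAddCommGroup E]

lemma sepFun_apply (p : E × E) : sepFun E p = ‖p.1 - p.2‖ / (1 + ‖p.1 - p.2‖) := rfl

lemma sepFun_nonneg (p : E × E) : 0 ≤ sepFun E p := by
  rw [sepFun_apply]; positivity

lemma sepFun_le_one (p : E × E) : sepFun E p ≤ 1 := by
  rw [sepFun_apply, div_le_one (by positivity)]
  linarith

lemma sepFun_le_sepFun_iff {p q : E × E} :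
    sepFun E p ≤ sepFun E q ↔ ‖p.1 - p.2‖ ≤ ‖q.1 - q.2‖ := by
  rw [sepFun_apply, sepFun_apply, div_le_div_iff₀ (by positivity) (by positivity)]
  constructor <;> intro h <;> linarith

lemma abs_sub_le_mul_sepFun {f : E →ᵇ ℝ} {L : ℝ}
    (hf : ∀ x y, |f x - f y| ≤ L * ‖x - y‖) (p : E × E) :
    |f p.2 - f p.1| ≤ (2 * ‖f‖ + L) * sepFun E p := by
  have h1 : |f p.2 - f p.1| ≤ L * ‖p.1 - p.2‖ := by
    rw [abs_sub_comm]; exact hf _ _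
  have h2 : |f p.2 - f p.1| ≤ 2 * ‖f‖ := by
    have h3 : |f p.1| ≤ ‖f‖ := f.norm_coe_le_norm p.1
    have h4 : |f p.2| ≤ ‖f‖ := f.norm_coe_le_norm p.2
    linarith [abs_sub (f p.2) (f p.1)]
  have h3 : 0 ≤ ‖p.1 - p.2‖ := norm_nonneg _
  rw [sepFun_apply, mul_div_assoc', le_div_iff₀ (by positivity)]
  nlinarith

end sepFun

/-- The map `S` is nonexpansive, and it moves two points by the same vector when it preserves their
distance. -/
structure IsRigidNonexpansive {E : Type*} [NormedAddCommGroup E] (S : E → E) : Prop where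
  norm_sub_le : ∀ x y, ‖S x - S y‖ ≤ ‖x - y‖
  sub_eq_sub : ∀ x y, ‖S x - S y‖ = ‖x - y‖ → S y - S x = y - x

lemma IsRigidNonexpansive.continuous {E : Type*} [NormedAddCommGroup E] {S : E → E}
    (hS : IsRigidNonexpansive S) : Continuous S :=
  (LipschitzWith.of_dist_le_mul (K := 1) fun x y => by
    simpa [dist_eq_norm] using hS.norm_sub_le x y).continuous

lemma isRigidNonexpansive_of_firmlyNonexpansive {E : Type*} [NormedAddCommGroup E] {S : E → E}
    {c : ℝ} (hc : 0 < c)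
    (hS : ∀ x y, ‖S x - S y‖ ^ 2 ≤ ‖x - y‖ ^ 2 - c * ‖(x - S x) - (y - S y)‖ ^ 2) :
    IsRigidNonexpansive S where
  norm_sub_le x y := by
    refine le_of_sq_le_sq ?_ (norm_nonneg _)
    have := hS x y
    have : 0 ≤ c * ‖(x - S x) - (y - S y)‖ ^ 2 := by positivity
    linarith
  sub_eq_sub x y h := by
    have h1 := hS x y
    rw [h] at h1
    have h2 : ‖(x - S x) - (y - S y)‖ ^ 2 ≤ 0 := by
      by_contra hcon
      have := mul_pos hc (not_le.1 hcon)
      linarith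
    have h3 : (x - S x) - (y - S y) = 0 :=
      norm_eq_zero.1 (pow_eq_zero_iff two_ne_zero |>.1 (le_antisymm h2 (by positivity)))
    have h4 : (S y - S x) - (y - x) = (x - S x) - (y - S y) := by abel
    exact sub_eq_zero.1 (h4.trans h3)

/-- The map moving two points simultaneously. -/
def pairMap {E I : Type*} (T : I → E → E) (i : I) (p : E × E) : E × E := (T i p.1, T i p.2)

lemma measurable_pairMap {E I : Type*} [MeasurableSpace E] [MeasurableSpace I] {T : I → E → E}
    (hm : ∀ x, Measurable fun i => T i x) (p : E × E) : Measurable fun i => pairMap T i p :=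
  (hm p.1).prodMk (hm p.2)

lemma continuous_pairMap {E I : Type*} [TopologicalSpace E] {T : I → E → E}
    (hc : ∀ i, Continuous (T i)) (i : I) : Continuous (pairMap T i) :=
  ((hc i).comp continuous_fst).prodMk ((hc i).comp continuous_snd)

section chain

variable {E I : Type*} [NormedAddCommGroup E] [MeasurableSpace E] [BorelSpace E]
  [MeasurableSpace I] {T : I → E → E}
  {ν : Measure I} [IsProbabilityMeasure ν]
  (hm : ∀ x, Measurable fun i => T i x) (hc : ∀ i, Continuous (T i))

lemma preservesLipschitz_avgOp (hT : ∀ i, IsRigidNonexpansive (T i)) :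
    PreservesLipschitz (avgOp ν T hm hc) := by
  intro L f hf x y
  rw [avgOp_apply, avgOp_apply, ← integral_sub (integrable_bcf_comp f (hm x))
    (integrable_bcf_comp f (hm y)), ← Real.norm_eq_abs]
  refine (norm_integral_le_of_norm_le_const (C := L * ‖x - y‖)
    (Eventually.of_forall fun i => ?_)).trans_eq (by simp)
  rcases eq_or_ne x y with rfl | hxy
  · simp
  have hL : 0 ≤ L := by
    have h1 := (abs_nonneg _).trans (hf x y)
    exact nonneg_of_mul_nonneg_left h1 (norm_pos_iff.2 (sub_ne_zero.2 hxy))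
  exact (hf _ _).trans (mul_le_mul_of_nonneg_left ((hT i).norm_sub_le x y) hL)

variable [SecondCountableTopology E]

lemma isCoupling_avgOp :
    IsCoupling (avgOp ν T hm hc)
      (avgOp ν (pairMap T) (measurable_pairMap hm) (continuous_pairMap hc))
      (avgOp ν (fun i y => (y, T i y)) (fun y => measurable_const.prodMk (hm y))
        (fun i => continuous_id.prodMk (hc i))) where
  markov := isMarkovOp_avgOp ..
  markov_pair := isMarkovOp_avgOp ..
  markov_init := isMarkovOp_avgOp ..
  fst f := rfl
  snd f := rfl
  init_mul f g := by
    ext x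
    simp [avgOp_apply, integral_const_mul]

lemma avgOp_sepFun_le (hT : ∀ i, IsRigidNonexpansive (T i)) (p : E × E) :
    avgOp ν (pairMap T) (measurable_pairMap hm) (continuous_pairMap hc) (sepFun E) p ≤
      sepFun E p := by
  rw [avgOp_apply]
  refine (integral_mono (integrable_bcf_comp _ (measurable_pairMap hm p)) (integrable_const _)
    (fun i => sepFun_le_sepFun_iff.2 ((hT i).norm_sub_le p.1 p.2))).trans_eq (by simp)

/-- If the expected separation of two coupled points never decreases, then the two chains move in
parallel. -/
lemma avgOp_pow_eq_of_sepFun_eq (hT : ∀ i, IsRigidNonexpansive (T i)) (f : E →ᵇ ℝ) (v : E)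
    (k : ℕ) (p : E × E) (hv : p.2 - p.1 = v)
    (hp : ∀ j ≤ k, ((avgOp ν (pairMap T) (measurable_pairMap hm) (continuous_pairMap hc)) ^ j)
      (sepFun E) p = sepFun E p) :
    ((avgOp ν T hm hc) ^ k) f p.2 =
      ((avgOp ν T hm hc) ^ k) (f.compContinuous ⟨fun x => x + v, by fun_prop⟩) p.1 := by
  set Q := avgOp ν (pairMap T) (measurable_pairMap hm) (continuous_pairMap hc) with hQ
  have hQm : IsMarkovOp Q := isMarkovOp_avgOp ..
  have hQV : ∀ p, Q (sepFun E) p ≤ sepFun E p := avgOp_sepFun_le hm hc hT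
  induction k generalizing p with
  | zero => simp [← hv]
  | succ k ih =>
    have hdec : ∀ j ≤ k, ∀ᵐ i ∂ν, (Q ^ j) (sepFun E) (pairMap T i p) = sepFun E p := by
      intro j hj
      have hle : ∀ i, (Q ^ j) (sepFun E) (pairMap T i p) ≤ sepFun E p := fun i =>
        (show (Q ^ j) (sepFun E) (pairMap T i p) ≤ sepFun E (pairMap T i p) by
          simpa using hQm.antitone_pow hQV (pairMap T i p) (Nat.zero_le j)).trans
          (sepFun_le_sepFun_iff.2 ((hT i).norm_sub_le p.1 p.2))
      have hintegral := integrable_bcf_comp (ν := ν) ((Q ^ j) (sepFun E)) (measurable_pairMap hm p)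
      have hzero : ∫ i, (sepFun E p - (Q ^ j) (sepFun E) (pairMap T i p)) ∂ν = 0 := by
        rw [integral_sub (integrable_const _) hintegral]
        have := hp (j + 1) (by omega)
        rw [pow_succ', Module.End.mul_apply, hQ, avgOp_apply, ← hQ] at this
        simp [this]
      have := (integral_eq_zero_iff_of_nonneg (fun i => sub_nonneg.2 (hle i))
        ((integrable_const _).sub hintegral)).1 hzero
      filter_upwards [this] with i hi
      exact (sub_eq_zero.1 hi).symm
    have hall : ∀ᵐ i ∂ν, ∀ j, j ≤ k → (Q ^ j) (sepFun E) (pairMap T i p) = sepFun E p := by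
      rw [ae_all_iff]
      intro j
      by_cases hj : j ≤ k
      · filter_upwards [hdec j hj] with i hi _ using hi
      · exact Eventually.of_forall fun i h => absurd h hj
    rw [pow_succ', Module.End.mul_apply, Module.End.mul_apply, avgOp_apply, avgOp_apply]
    refine integral_congr_ae ?_
    filter_upwards [hall] with i hi
    have h0 : sepFun E (pairMap T i p) = sepFun E p := by simpa using hi 0 (Nat.zero_le k)
    refine ih (pairMap T i p) ?_ fun j hj => (hi j hj).trans h0.symm
    rw [← hv]
    exact (hT i).sub_eq_sub _ _ (le_antisymm (sepFun_le_sepFun_iff.1 h0.le)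
      (sepFun_le_sepFun_iff.1 h0.ge))

end chain

/-- A bounded increasing function of one coordinate. -/
noncomputable def coordFun {ι : Type*} [Fintype ι] (i : ι) : EuclideanSpace ℝ ι →ᵇ ℝ :=
  BoundedContinuousFunction.ofNormedAddCommGroup (fun x => Real.arctan (x i)) (by fun_prop)
    (Real.pi / 2) (fun x => (abs_lt.2 ⟨Real.neg_pi_div_two_lt_arctan _,
      Real.arctan_lt_pi_div_two _⟩).le)

section euclidean

variable {ι : Type*} [Fintype ι]

lemma coordFun_apply (i : ι) (x : EuclideanSpace ℝ ι) : coordFun i x = Real.arctan (x i) := rfl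

lemma abs_arctan_sub_le (a b : ℝ) : |Real.arctan a - Real.arctan b| ≤ |a - b| := by
  have h := Convex.norm_image_sub_le_of_norm_deriv_le (𝕜 := ℝ) (f := Real.arctan) (C := 1)
    (s := Set.univ) (fun x _ => Real.differentiable_arctan x)
    (fun x _ => by
      rw [Real.deriv_arctan, Real.norm_of_nonneg (by positivity), div_le_one (by positivity)]
      nlinarith [sq_nonneg x])
    convex_univ (Set.mem_univ b) (Set.mem_univ a)
  simpa using h

lemma coordFun_lipschitz (i : ι) (x y : EuclideanSpace ℝ ι) :
    |coordFun i x - coordFun i y| ≤ 1 * ‖x - y‖ := by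
  rw [one_mul]
  exact (abs_arctan_sub_le _ _).trans (by simpa using PiLp.norm_apply_le (x - y) i)

variable {I : Type*} [MeasurableSpace I] {T : I → EuclideanSpace ℝ ι → EuclideanSpace ℝ ι}
  {ν : Measure I} [IsProbabilityMeasure ν]
  (hm : ∀ x, Measurable fun i => T i x) (hc : ∀ i, Continuous (T i))

/-- Along two chains moving in parallel, a coordinate which differs is detected by the averages of
the corresponding coordinate function. -/
lemma exists_pos_le_avgOp_pow_sub (hT : ∀ i, IsRigidNonexpansive (T i))
    (ht : OrbitTight (avgOp ν T hm hc)) (p : EuclideanSpace ℝ ι × EuclideanSpace ℝ ι)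
    (hp : ∀ j : ℕ, ((avgOp ν (pairMap T) (measurable_pairMap hm) (continuous_pairMap hc)) ^ j)
      (sepFun _) p = sepFun _ p) (i : ι) :
    (p.1 i < p.2 i → ∃ δ > 0, ∀ k, δ ≤ ((avgOp ν T hm hc) ^ k) (coordFun i) p.2 -
      ((avgOp ν T hm hc) ^ k) (coordFun i) p.1) ∧
    (p.2 i < p.1 i → ∃ δ > 0, ∀ k, δ ≤ ((avgOp ν T hm hc) ^ k) (coordFun i) p.1 -
      ((avgOp ν T hm hc) ^ k) (coordFun i) p.2) := by
  set g : EuclideanSpace ℝ ι →ᵇ ℝ := (coordFun i).compContinuous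
    ⟨fun x => x + (p.2 - p.1), by fun_prop⟩ with hg
  have hgapp : ∀ x, g x = Real.arctan (x i + (p.2 i - p.1 i)) := fun x => rfl
  have hpow := fun k => avgOp_pow_eq_of_sepFun_eq hm hc hT (coordFun i) (p.2 - p.1) k p rfl
    fun j _ => hp j
  constructor <;> intro h
  · obtain ⟨δ, hδ, hk⟩ := exists_pos_le_pow (isMarkovOp_avgOp ..) ht (g - coordFun i)
      (fun x => by
        rw [BoundedContinuousFunction.sub_apply, hgapp, coordFun_apply, sub_pos]
        exact Real.arctan_strictMono (by linarith)) p.1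
    refine ⟨δ, hδ, fun k => ?_⟩
    simpa only [map_sub, BoundedContinuousFunction.sub_apply, hpow] using hk k
  · obtain ⟨δ, hδ, hk⟩ := exists_pos_le_pow (isMarkovOp_avgOp ..) ht (coordFun i - g)
      (fun x => by
        rw [BoundedContinuousFunction.sub_apply, hgapp, coordFun_apply, sub_pos]
        exact Real.arctan_strictMono (by linarith)) p.1
    refine ⟨δ, hδ, fun k => ?_⟩
    simpa only [map_sub, BoundedContinuousFunction.sub_apply, hpow] using hk k

/-- For a tight chain driven by rigid nonexpansive maps, the averages of bounded Lipschitz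
functions converge pointwise. -/
lemma exists_tendsto_avgOp_pow (hT : ∀ i, IsRigidNonexpansive (T i))
    (ht : OrbitTight (avgOp ν T hm hc)) (f : EuclideanSpace ℝ ι →ᵇ ℝ) {L : ℝ}
    (hf : ∀ x y, |f x - f y| ≤ L * ‖x - y‖) :
    ∃ g : EuclideanSpace ℝ ι →ᵇ ℝ, ∀ x,
      Tendsto (fun k => ((avgOp ν T hm hc) ^ k) f x) atTop (𝓝 (g x)) := by
  have hf' : ∀ x y, |f x - f y| ≤ |L| * ‖x - y‖ := fun x y =>
    (hf x y).trans (mul_le_mul_of_nonneg_right (le_abs_self L) (norm_nonneg _))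
  have hP : IsMarkovOp (avgOp ν T hm hc) := isMarkovOp_avgOp ..
  have hL := preservesLipschitz_avgOp (ν := ν) hm hc hT
  have hcoup := isCoupling_avgOp (ν := ν) hm hc
  choose h hh hinc using fun i : ι =>
    exists_invariant_function hP hL ht (coordFun i) (coordFun_lipschitz i)
  refine exists_tendsto_pow hP hL ht f hf fun x =>
    tendsto_pow_succ_sub hcoup (V := sepFun _) (C := 2 * ‖f‖ + |L|) (fun ε hε => ?_)
      (by positivity) (abs_sub_le_mul_sepFun hf')
  refine exists_init_pow_le hcoup ht sepFun_nonneg sepFun_le_one (avgOp_sepFun_le hm hc hT) h hh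
    (fun p hp heq => ?_) x hε
  have hp12 : p.1 = p.2 := by
    ext i
    by_contra hne
    have key := exists_pos_le_avgOp_pow_sub hm hc hT ht p hp i
    rcases lt_or_gt_of_ne hne with hlt | hlt
    · obtain ⟨δ, hδ, hk⟩ := key.1 hlt
      linarith [hinc i _ _ δ hk, heq i]
    · obtain ⟨δ, hδ, hk⟩ := key.2 hlt
      linarith [hinc i _ _ δ hk, heq i]
  simp [sepFun_apply, hp12]

end euclidean

/-- convergence for α-firmly nonexpansive mappings on ℝⁿ: each
`T i : ℝⁿ → ℝⁿ` is α-firmly nonexpansive with constant `αᵢ ≤ α < 1`, and the Markov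
operator has an invariant probability measure.  Then for every initial distribution `μ₀`
the distributions `μ₀𝒫ᵏ` converge in distribution to an invariant probability measure. -/
theorem stmt10
    {n : ℕ} {I : Type*} [MeasurableSpace I]
    (T : I → EuclideanSpace ℝ (Fin n) → EuclideanSpace ℝ (Fin n))
    (α : ℝ) (hα : α < 1)
    (hfne : ∀ i : I, ∃ αi : ℝ, 0 < αi ∧ αi ≤ α ∧
      ∀ x y : EuclideanSpace ℝ (Fin n),
        ‖T i x - T i y‖ ^ 2 ≤ ‖x - y‖ ^ 2 -
          ((1 - αi) / αi) * ‖(x - T i x) - (y - T i y)‖ ^ 2)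
    (hΦ : Measurable fun p : EuclideanSpace ℝ (Fin n) × I => T p.2 p.1)
    (μξ : Measure I) [IsProbabilityMeasure μξ]
    (hinv : ∃ π : Measure (EuclideanSpace ℝ (Fin n)),
      IsProbabilityMeasure π ∧ markovStep μξ T π = π)
    (μ₀ : Measure (EuclideanSpace ℝ (Fin n))) [IsProbabilityMeasure μ₀] :
    ∃ π : Measure (EuclideanSpace ℝ (Fin n)),
      IsProbabilityMeasure π ∧ markovStep μξ T π = π ∧
      ∀ f : BoundedContinuousFunction (EuclideanSpace ℝ (Fin n)) ℝ,
        Tendsto (fun k => ∫ x, f x ∂((markovStep μξ T)^[k] μ₀)) atTop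
          (nhds (∫ x, f x ∂π)) := by
  have hT : ∀ i, IsRigidNonexpansive (T i) := by
    intro i
    obtain ⟨αi, h0, hle, h⟩ := hfne i
    exact isRigidNonexpansive_of_firmlyNonexpansive (div_pos (by linarith) h0) h
  have hm : ∀ x, Measurable fun i => T i x := fun x => hΦ.comp measurable_prodMk_left
  have hc : ∀ i, Continuous (T i) := fun i => (hT i).continuous
  obtain ⟨π, hπ, hπinv⟩ := hinv
  have hP : IsMarkovOp (avgOp μξ T hm hc) := isMarkovOp_avgOp ..
  have hL := preservesLipschitz_avgOp (ν := μξ) hm hc hT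
  have hπP : ∀ f : EuclideanSpace ℝ (Fin n) →ᵇ ℝ,
      ∫ x, avgOp μξ T hm hc f x ∂π = ∫ x, f x ∂π := fun f => by
    rw [← integral_markovStep_s10 hΦ hm hc π f, hπinv]
  have ht := orbitTight_of_invariant hP hL hπP
  obtain ⟨ρ, hρinv, hρlim⟩ := exists_tendsto_of_tendsto_pow hP hL hπP (μ₀ := μ₀)
    (μ := fun k => ⟨(markovStep μξ T)^[k] μ₀, isProbabilityMeasure_markovStep_iterate_s10 hΦ μ₀ k⟩)
    (fun k f => integral_markovStep_iterate hΦ hm hc μ₀ k f)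
    (fun f L hf => exists_tendsto_avgOp_pow hm hc hT ht f hf)
  refine ⟨ρ, inferInstance, ?_, hρlim⟩
  have := isProbabilityMeasure_markovStep_s10 hΦ (μξ := μξ) (ρ : Measure (EuclideanSpace ℝ (Fin n)))
  refine ext_of_forall_integral_eq_of_IsFiniteMeasure fun f => ?_
  rw [integral_markovStep_s10 hΦ hm hc, hρinv]
end
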